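/- arXiv:2408.04185 — 2 statements merged into one kernel-verified Lean document; each statement's English description precedes it below -/
import Mathlib

section
/- Let n and r be integers with 1 ≤ r < n. Then there exists a bijection Φ from S_{n-1} × {0, 1, ..., n-1} onto S_n such that for every π ∈ S_{n-1} and every c with 0 ≤ c ≤ n-1: exc_r(Φ(π,c)) = exc_r(π) if 0 ≤ c ≤ exc_r(π) + r - 1, and exc_r(Φ(π,c)) = exc_r(π) + 1 otherwise; and den_r(Φ(π,c)) = den_r(π) + c. -/
open Finset

/-- The value of the permutation `π ∈ S_n` at the (1-based) position `i`,
in one-line notation with letters `1,…,n`; `0` if `i` is out of range. -/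
def pval {n : ℕ} (π : Equiv.Perm (Fin n)) (i : ℕ) : ℕ :=
  if h : 1 ≤ i ∧ i ≤ n then ((π ⟨i - 1, by omega⟩ : Fin n) : ℕ) + 1 else 0

/-- The number of inversions of a word `w`, i.e. pairs of positions `i < j`
with `w_i > w_j`. -/
def winv (w : List ℕ) : ℕ :=
  ((Finset.range w.length ×ˢ Finset.range w.length).filter
    (fun p => p.1 < p.2 ∧ w.getD p.2 0 < w.getD p.1 0)).card

/-- `rDes(π) = {i ∈ [n-1] : π_i ≥ π_{i+1} + r}`. -/
def rDesSet {n : ℕ} (r : ℕ) (π : Equiv.Perm (Fin n)) : Finset ℕ :=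
  (Finset.Icc 1 (n - 1)).filter (fun i => pval π (i + 1) + r ≤ pval π i)

/-- The `r`-descent number `rdes(π)`. -/
def rdes {n : ℕ} (r : ℕ) (π : Equiv.Perm (Fin n)) : ℕ := (rDesSet r π).card

/-- `rInv(π) = {(i,j) : i < j, π_i > π_j, π_i < π_j + r}`. -/
def rInvSet {n : ℕ} (r : ℕ) (π : Equiv.Perm (Fin n)) : Finset (ℕ × ℕ) :=
  ((Finset.Icc 1 n) ×ˢ (Finset.Icc 1 n)).filter
    (fun p => p.1 < p.2 ∧ pval π p.2 < pval π p.1 ∧ pval π p.1 < pval π p.2 + r)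

/-- The `r`-major index `rmaj(π) = ∑_{i ∈ rDes(π)} i + |rInv(π)|`. -/
def rmaj {n : ℕ} (r : ℕ) (π : Equiv.Perm (Fin n)) : ℕ :=
  (∑ i ∈ rDesSet r π, i) + (rInvSet r π).card

/-- The inversion number `inv(π)`: the number of pairs `i < j` with `π_i > π_j`. -/
def invStat {n : ℕ} (π : Equiv.Perm (Fin n)) : ℕ :=
  (((Finset.Icc 1 n) ×ˢ (Finset.Icc 1 n)).filter
    (fun p => p.1 < p.2 ∧ pval π p.2 < pval π p.1)).card

/-- `Excp_r(π)`: the set of `r`-level excedance places, i.e. indices `i`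
with `π_i > i` and `π_i ≥ r`. -/
def excpSet {n : ℕ} (r : ℕ) (π : Equiv.Perm (Fin n)) : Finset ℕ :=
  (Finset.Icc 1 n).filter (fun i => i < pval π i ∧ r ≤ pval π i)

/-- `Exc_r(π)`: the subword of `π` on the `r`-level excedance places,
in increasing order of position. -/
def excWord {n : ℕ} (r : ℕ) (π : Equiv.Perm (Fin n)) : List ℕ :=
  ((excpSet r π).sort (· ≤ ·)).map (pval π)

/-- `Nexc_r(π)`: the subword of `π` on the non-`r`-level-excedance places,
in increasing order of position. -/
def nexcWord {n : ℕ} (r : ℕ) (π : Equiv.Perm (Fin n)) : List ℕ :=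
  (((Finset.Icc 1 n) \ excpSet r π).sort (· ≤ ·)).map (pval π)

/-- The `r`-level Denert statistic
`den_r(π) = ∑_{i ∈ Excp_r(π)} i + inv(Exc_r(π)) + inv(Nexc_r(π))`. -/
def denr {n : ℕ} (r : ℕ) (π : Equiv.Perm (Fin n)) : ℕ :=
  (∑ i ∈ excpSet r π, i) + winv (excWord r π) + winv (nexcWord r π)

/-- The `r`-level excedance number `exc_r(π) = |{i : π_i > i ≥ r}|`. -/
def excr {n : ℕ} (r : ℕ) (π : Equiv.Perm (Fin n)) : ℕ :=
  ((Finset.Icc 1 n).filter (fun i => r ≤ i ∧ i < pval π i)).card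

theorem winv_sort_map (S : Finset ℕ) (f : ℕ → ℕ) :
    winv ((S.sort (· ≤ ·)).map f) =
      ∑ i ∈ S, ∑ j ∈ S, if i < j ∧ f j < f i then 1 else 0 := by
  rw [← Finset.sum_product', ← Finset.card_filter, winv]
  set l := S.sort (· ≤ ·) with hl
  have hm : ∀ i (h : i < l.length), l[i] ∈ S := fun i h => by
    rw [← Finset.mem_sort (· ≤ ·)]; exact List.getElem_mem h
  have hlt : ∀ i j (hi : i < l.length) (hj : j < l.length), l[i] < l[j] ↔ i < j := by
    intro i j hi hj
    exact (Finset.sortedLT_sort S).strictMono_get.lt_iff_lt (a := ⟨i, hi⟩) (b := ⟨j, hj⟩)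
  have hD : ∀ i (h : i < l.length), (l.map f).getD i 0 = f l[i] := by
    intro i h; simp [List.getD, h]
  refine Finset.card_bij (fun p hp => (l.getD p.1 0, l.getD p.2 0)) ?_ ?_ ?_
  · rintro ⟨i, j⟩ hp
    simp only [List.length_map, mem_filter, mem_product, mem_range] at hp ⊢
    obtain ⟨⟨hi, hj⟩, h1, h2⟩ := hp
    rw [hD _ hi, hD _ hj] at h2
    simp only [List.getD_eq_getElem _ _ hi, List.getD_eq_getElem _ _ hj]
    exact ⟨⟨hm _ hi, hm _ hj⟩, (hlt _ _ hi hj).2 h1, h2⟩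
  · rintro ⟨i, j⟩ hp ⟨i', j'⟩ hp' h
    simp only [List.length_map, mem_filter, mem_product, mem_range] at hp hp'
    obtain ⟨⟨hi, hj⟩, -⟩ := hp
    obtain ⟨⟨hi', hj'⟩, -⟩ := hp'
    simp only [List.getD_eq_getElem _ _ hi, List.getD_eq_getElem _ _ hj,
      List.getD_eq_getElem _ _ hi', List.getD_eq_getElem _ _ hj', Prod.mk.injEq] at h
    have a1 := hlt i i' hi hi'
    have a2 := hlt i' i hi' hi
    have a3 := hlt j j' hj hj'
    have a4 := hlt j' j hj' hj
    simp only [Prod.mk.injEq]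
    omega
  · rintro ⟨x, y⟩ hp
    simp only [mem_filter, mem_product] at hp
    obtain ⟨⟨hx, hy⟩, h1, h2⟩ := hp
    rw [← Finset.mem_sort (· ≤ ·), ← hl] at hx hy
    obtain ⟨i, hi, rfl⟩ := List.mem_iff_getElem.1 hx
    obtain ⟨j, hj, rfl⟩ := List.mem_iff_getElem.1 hy
    refine ⟨(i, j), ?_, ?_⟩
    · simp only [List.length_map, mem_filter, mem_product, mem_range]
      rw [hD _ hi, hD _ hj]
      exact ⟨⟨hi, hj⟩, (hlt _ _ hi hj).1 h1, h2⟩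
    · simp [hi, hj]

theorem sum_Icc_one_eq_sum_fin (n : ℕ) (F : ℕ → ℕ) :
    ∑ i ∈ Finset.Icc 1 n, F i = ∑ i : Fin n, F (i + 1) := by
  rw [Fin.sum_univ_eq_sum_range (fun i => F (i + 1)), Finset.range_eq_Ico,
    Finset.sum_Ico_add' (fun i => F i) 0 n 1]
  rfl

theorem pval_succ {n : ℕ} (π : Equiv.Perm (Fin n)) (i : Fin n) :
    pval π (i + 1) = (π i : ℕ) + 1 := by
  have : 1 ≤ (i : ℕ) + 1 ∧ (i : ℕ) + 1 ≤ n := by omega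
  simp [pval, this]

/-- Place `i` (numbered from `0`) carries an `r`-level excedance letter of `π`. -/
def LevelExc {n : ℕ} (r : ℕ) (π : Equiv.Perm (Fin n)) (i : Fin n) : Prop :=
  (i : ℕ) < π i ∧ r ≤ (π i : ℕ) + 1

instance {n : ℕ} (r : ℕ) (π : Equiv.Perm (Fin n)) : DecidablePred (LevelExc r π) :=
  fun _ => inferInstanceAs (Decidable (_ ∧ _))

theorem mem_excpSet_succ {n : ℕ} (r : ℕ) (π : Equiv.Perm (Fin n)) (i : Fin n) :
    (i : ℕ) + 1 ∈ excpSet r π ↔ LevelExc r π i := by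
  simp only [excpSet, mem_filter, mem_Icc, pval_succ, LevelExc]
  omega

theorem denr_eq {n : ℕ} (r : ℕ) (π : Equiv.Perm (Fin n)) :
    denr r π = ∑ i, (if LevelExc r π i then (i : ℕ) + 1 else 0) +
      ∑ i, ∑ j, (if i < j ∧ π j < π i ∧ (LevelExc r π i ↔ LevelExc r π j) then 1 else 0) := by
  have hE (F : ℕ → ℕ) : ∑ i ∈ excpSet r π, F i =
      ∑ i : Fin n, if LevelExc r π i then F (i + 1) else 0 := by
    have : excpSet r π = (Finset.Icc 1 n).filter (· ∈ excpSet r π) := by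
      ext i; simp only [mem_filter, iff_and_self]
      exact fun h => (Finset.mem_filter.1 h).1
    rw [this, Finset.sum_filter, sum_Icc_one_eq_sum_fin]
    simp only [mem_excpSet_succ]
  have hN (F : ℕ → ℕ) : ∑ i ∈ Finset.Icc 1 n \ excpSet r π, F i =
      ∑ i : Fin n, if ¬ LevelExc r π i then F (i + 1) else 0 := by
    have : Finset.Icc 1 n \ excpSet r π = (Finset.Icc 1 n).filter (· ∉ excpSet r π) := by
      ext i; simp
    rw [this, Finset.sum_filter, sum_Icc_one_eq_sum_fin]
    simp only [mem_excpSet_succ]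
  rw [denr, excWord, nexcWord, winv_sort_map, winv_sort_map]
  simp only [hE, hN, pval_succ]
  rw [add_assoc, ← Finset.sum_add_distrib]
  congr 1
  refine Finset.sum_congr rfl fun i _ => ?_
  by_cases hi : LevelExc r π i
  · simp only [hi, if_true, not_true, if_false, add_zero, true_iff]
    refine Finset.sum_congr rfl fun j _ => ?_
    by_cases hj : LevelExc r π j <;> simp [hj]
  · simp only [hi, if_true, not_false_eq_true, if_false, zero_add, false_iff]
    refine Finset.sum_congr rfl fun j _ => ?_
    by_cases hj : LevelExc r π j <;> simp [hj]

theorem excr_eq {n : ℕ} (r : ℕ) (π : Equiv.Perm (Fin n)) :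
    excr r π = ∑ i, if LevelExc r π i ∧ r ≤ (i : ℕ) + 1 then 1 else 0 := by
  rw [excr, Finset.card_filter, sum_Icc_one_eq_sum_fin]
  refine Finset.sum_congr rfl fun i _ => ?_
  simp only [pval_succ, LevelExc]
  congr 1
  simp only [eq_iff_iff]
  omega

section Insertion

variable {N : ℕ} (r : ℕ) (π : Equiv.Perm (Fin N)) (v : Fin (N + 1))

/-- Place `i` carries an `r`-level excedance letter which is at least `v`. -/
def Lifted (i : Fin N) : Prop := LevelExc r π i ∧ v ≤ (π i).castSucc

instance : DecidablePred (Lifted r π v) := fun _ => inferInstanceAs (Decidable (_ ∧ _))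

/-- The `r`-level excedance letters of `π` that are at least `v`, together with the new
largest letter. -/
def liftSet : Finset (Fin (N + 1)) :=
  insert (Fin.last N) ((univ.filter (Lifted r π v)).image fun i => (π i).castSucc)

theorem last_mem_liftSet : Fin.last N ∈ liftSet r π v := by simp [liftSet]

theorem castSucc_mem_liftSet (i : Fin N) :
    (π i).castSucc ∈ liftSet r π v ↔ Lifted r π v i := by
  simp only [liftSet, mem_insert, mem_image, mem_filter, mem_univ, true_and,
    Fin.castSucc_ne_last, false_or, Fin.castSucc_inj, EmbeddingLike.apply_eq_iff_eq,
    exists_eq_right]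

theorem le_of_mem_liftSet {x : Fin (N + 1)} (hx : x ∈ liftSet r π v) : v ≤ x := by
  simp only [liftSet, mem_insert, mem_image, mem_filter, mem_univ, true_and] at hx
  obtain rfl | ⟨i, hi, rfl⟩ := hx
  · exact Fin.le_last v
  · exact hi.2

theorem level_of_mem_liftSet (hr : r ≤ N + 1) {x : Fin (N + 1)} (hx : x ∈ liftSet r π v) :
    r ≤ (x : ℕ) + 1 := by
  simp only [liftSet, mem_insert, mem_image, mem_filter, mem_univ, true_and] at hx
  obtain rfl | ⟨i, hi, rfl⟩ := hx
  · simpa using hr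
  · exact hi.1.2

/-- The letter of `T` following `x` (where `T` contains the largest letter). -/
def nextLetter (T : Finset (Fin (N + 1))) (x : Fin N) : Fin (N + 1) :=
  (T.filter (x.castSucc < ·)).inf id

theorem castSucc_lt_nextLetter (T : Finset (Fin (N + 1))) (x : Fin N) :
    x.castSucc < nextLetter T x := by
  rw [nextLetter, Finset.lt_inf_iff (Fin.castSucc_lt_last x)]
  intro b hb
  exact (mem_filter.1 hb).2

theorem nextLetter_le {T : Finset (Fin (N + 1))} {x : Fin N} {y : Fin (N + 1)} (hy : y ∈ T)
    (h : x.castSucc < y) : nextLetter T x ≤ y :=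
  Finset.inf_le (f := id) (mem_filter.2 ⟨hy, h⟩)

theorem nextLetter_mem {T : Finset (Fin (N + 1))} (hT : Fin.last N ∈ T) (x : Fin N) :
    nextLetter T x ∈ T := by
  have hne : (T.filter (x.castSucc < ·)).Nonempty :=
    ⟨_, mem_filter.2 ⟨hT, Fin.castSucc_lt_last x⟩⟩
  obtain ⟨b, hb, h⟩ := Finset.exists_mem_eq_inf _ hne id
  rw [nextLetter, h]
  exact (mem_filter.1 hb).1

/-- The smallest letter of `liftSet r π v`. -/
def newLetter : Fin (N + 1) := (liftSet r π v).min' ⟨_, last_mem_liftSet r π v⟩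

theorem newLetter_mem : newLetter r π v ∈ liftSet r π v := Finset.min'_mem _ _

theorem newLetter_le {x : Fin (N + 1)} (hx : x ∈ liftSet r π v) : newLetter r π v ≤ x :=
  Finset.min'_le _ _ hx

/-- The letter which replaces `π i` after the insertion. -/
def liftLetter (i : Fin N) : Fin (N + 1) :=
  if Lifted r π v i then nextLetter (liftSet r π v) (π i) else (π i).castSucc

variable {r π v}

theorem liftLetter_of_lifted {i : Fin N} (h : Lifted r π v i) :
    liftLetter r π v i = nextLetter (liftSet r π v) (π i) := if_pos h

theorem liftLetter_of_not_lifted {i : Fin N} (h : ¬ Lifted r π v i) :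
    liftLetter r π v i = (π i).castSucc := if_neg h

theorem liftLetter_mem_iff {i : Fin N} : liftLetter r π v i ∈ liftSet r π v ↔ Lifted r π v i := by
  by_cases h : Lifted r π v i
  · simp [h, liftLetter_of_lifted, nextLetter_mem (last_mem_liftSet r π v)]
  · rw [liftLetter_of_not_lifted h, castSucc_mem_liftSet]

theorem newLetter_lt_liftLetter {i : Fin N} (h : Lifted r π v i) :
    newLetter r π v < liftLetter r π v i := by
  rw [liftLetter_of_lifted h]
  exact lt_of_le_of_lt (newLetter_le r π v ((castSucc_mem_liftSet r π v i).2 h))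
    (castSucc_lt_nextLetter _ _)

theorem nextLetter_lt_nextLetter {T : Finset (Fin (N + 1))} {x y : Fin N}
    (hy : y.castSucc ∈ T) (h : x < y) : nextLetter T x < nextLetter T y :=
  lt_of_le_of_lt (nextLetter_le hy (by simpa using h)) (castSucc_lt_nextLetter _ _)

theorem liftLetter_injective : Function.Injective (liftLetter r π v) := by
  intro i j h
  have hij := liftLetter_mem_iff (r := r) (π := π) (v := v) (i := i)
  rw [h, liftLetter_mem_iff] at hij
  by_cases hi : Lifted r π v i
  · have hj := hij.2 hi
    rw [liftLetter_of_lifted hi, liftLetter_of_lifted hj] at h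
    by_contra hne
    rcases lt_or_gt_of_ne (fun h' => hne (π.injective h')) with h' | h'
    · exact (nextLetter_lt_nextLetter ((castSucc_mem_liftSet r π v j).2 hj) h').ne h
    · exact (nextLetter_lt_nextLetter ((castSucc_mem_liftSet r π v i).2 hi) h').ne' h
  · have hj := fun h => hi (hij.1 h)
    rw [liftLetter_of_not_lifted hi, liftLetter_of_not_lifted hj] at h
    exact π.injective (Fin.castSucc_injective _ h)

theorem liftLetter_ne_newLetter (i : Fin N) : liftLetter r π v i ≠ newLetter r π v := by
  intro h
  have hi : Lifted r π v i := by
    rw [← liftLetter_mem_iff, h]; exact newLetter_mem r π v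
  exact (newLetter_lt_liftLetter hi).ne' h

theorem insertNth_injective {N : ℕ} (v : Fin (N + 1)) {e : Fin (N + 1)} {w : Fin N → Fin (N + 1)}
    (hw : Function.Injective w) (he : ∀ i, w i ≠ e) :
    Function.Injective (v.insertNth e w : Fin (N + 1) → Fin (N + 1)) := by
  intro a b
  cases a using Fin.succAboveCases v with
  | x =>
    cases b using Fin.succAboveCases v with
    | x => simp
    | p j => simpa using fun h => (he j h.symm).elim
  | p i =>
    cases b using Fin.succAboveCases v with
    | x => simpa using fun h => (he i h).elim
    | p j => simpa using fun h => hw h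

variable (r π v)

/-- Insert the smallest letter of `liftSet r π v` at place `v` of `π`, every other letter
of that set being replaced by the following one. -/
noncomputable def insertPlace : Equiv.Perm (Fin (N + 1)) :=
  Equiv.ofBijective _ (Finite.injective_iff_bijective.1
    (insertNth_injective v (liftLetter_injective (r := r) (π := π) (v := v))
      liftLetter_ne_newLetter))

@[simp] theorem insertPlace_same : insertPlace r π v v = newLetter r π v := by
  simp [insertPlace]

@[simp] theorem insertPlace_succAbove (i : Fin N) :
    insertPlace r π v (v.succAbove i) = liftLetter r π v i := by
  simp [insertPlace]

variable {r π v}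

theorem succAbove_val (v : Fin (N + 1)) (i : Fin N) :
    (v.succAbove i : ℕ) = if (i : ℕ) < v then (i : ℕ) else i + 1 := by
  simp only [Fin.succAbove, Fin.lt_def, Fin.val_castSucc]
  split_ifs <;> simp

theorem levelExc_insertPlace_succAbove (i : Fin N) :
    LevelExc r (insertPlace r π v) (v.succAbove i) ↔ LevelExc r π i := by
  simp only [LevelExc, insertPlace_succAbove, succAbove_val]
  by_cases h : Lifted r π v i
  · have h1 := castSucc_lt_nextLetter (liftSet r π v) (π i)
    have h2 := h.1
    rw [liftLetter_of_lifted h]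
    rw [Fin.lt_def, Fin.val_castSucc] at h1
    simp only [LevelExc] at h2
    split_ifs <;> omega
  · rw [liftLetter_of_not_lifted h]
    simp only [Lifted, LevelExc, Fin.le_def, Fin.val_castSucc] at h ⊢
    split_ifs <;> omega

theorem levelExc_insertPlace_same (hr : r ≤ N + 1) :
    LevelExc r (insertPlace r π v) v ↔ v < newLetter r π v := by
  have := level_of_mem_liftSet r π v hr (newLetter_mem r π v)
  simp [LevelExc, this]

/-- The letters of `liftSet r π v` can be read off from the result of the insertion. -/
theorem insertPlace_mem_liftSet_iff (w : Fin (N + 1)) :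
    insertPlace r π v w ∈ liftSet r π v ↔ v ≤ insertPlace r π v w ∧
      (w = v ∨ LevelExc r (insertPlace r π v) w) := by
  cases w using Fin.succAboveCases v with
  | x => simpa [newLetter_mem] using le_of_mem_liftSet r π v (newLetter_mem r π v)
  | p i =>
    simp only [insertPlace_succAbove, liftLetter_mem_iff, Fin.succAbove_ne, false_or,
      levelExc_insertPlace_succAbove]
    by_cases h : Lifted r π v i
    · simp only [h, true_iff]
      exact ⟨le_of_mem_liftSet r π v (liftLetter_mem_iff.2 h), h.1⟩
    · simp only [h, false_iff, liftLetter_of_not_lifted h]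
      exact fun h' => h ⟨h'.2, h'.1⟩

end Insertion

/-- Place `y` carries a letter that is at least `y` and at least the level `r`, and no
`r`-level excedance letter lies in the interval from `y` to just below that letter. -/
def IsGrandPlace {n : ℕ} (r : ℕ) (σ : Equiv.Perm (Fin n)) (y : Fin n) : Prop :=
  y ≤ σ y ∧ r ≤ (σ y : ℕ) + 1 ∧ ∀ w, LevelExc r σ w → y ≤ σ w → σ y ≤ σ w

section Injectivity

variable {N r : ℕ}

theorem isGrandPlace_insertPlace (hr : r ≤ N + 1) (π : Equiv.Perm (Fin N)) (v : Fin (N + 1)) :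
    IsGrandPlace r (insertPlace r π v) v := by
  rw [IsGrandPlace, insertPlace_same]
  refine ⟨le_of_mem_liftSet r π v (newLetter_mem r π v),
    level_of_mem_liftSet r π v hr (newLetter_mem r π v), fun w hw hv => ?_⟩
  exact newLetter_le r π v ((insertPlace_mem_liftSet_iff w).2 ⟨hv, .inr hw⟩)

theorem not_isGrandPlace_insertPlace (π : Equiv.Perm (Fin N)) {v y : Fin (N + 1)} (hvy : v < y) :
    ¬ IsGrandPlace r (insertPlace r π v) y := by
  rintro ⟨h1, h2, h3⟩
  cases y using Fin.succAboveCases v with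
  | x => exact lt_irrefl _ hvy
  | p i =>
    have hs := succAbove_val v i
    rw [insertPlace_succAbove] at h1 h2 h3
    rw [Fin.lt_def] at hvy
    rw [Fin.le_def] at h1
    by_cases h : Lifted r π v i
    · have hn := castSucc_lt_nextLetter (liftSet r π v) (π i)
      obtain ⟨w, hw⟩ := (insertPlace r π v).surjective (π i).castSucc
      have hi := h.1.1
      have hyw : (v.succAbove i : ℕ) ≤ π i := by split_ifs at hs <;> omega
      have hT := (insertPlace_mem_liftSet_iff (r := r) (π := π) (v := v) w).1
        (hw ▸ (castSucc_mem_liftSet r π v i).2 h)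
      have hE : LevelExc r (insertPlace r π v) w := by
        rcases hT.2 with rfl | h'
        · refine ⟨?_, ?_⟩ <;> rw [hw, Fin.val_castSucc]
          · omega
          · exact h.1.2
        · exact h'
      have h4 := h3 w hE (by rw [hw, Fin.le_def]; exact hyw)
      rw [hw, liftLetter_of_lifted h] at h4
      exact absurd hn (not_lt.2 h4)
    · rw [liftLetter_of_not_lifted h, Fin.val_castSucc] at h1 h2
      refine h ⟨⟨?_, h2⟩, ?_⟩
      · split_ifs at hs <;> omega
      · rw [Fin.le_def, Fin.val_castSucc]; omega

theorem insertPlace_injective (hr : r ≤ N + 1) {π π' : Equiv.Perm (Fin N)} {v v' : Fin (N + 1)}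
    (h : insertPlace r π v = insertPlace r π' v') : π = π' ∧ v = v' := by
  obtain rfl : v = v' := by
    rcases lt_trichotomy v v' with hv | hv | hv
    · exact absurd (h ▸ isGrandPlace_insertPlace hr π' v') (not_isGrandPlace_insertPlace π hv)
    · exact hv
    · exact absurd (h ▸ isGrandPlace_insertPlace hr π v) (not_isGrandPlace_insertPlace π' hv)
  refine ⟨?_, rfl⟩
  have hT : liftSet r π v = liftSet r π' v := by
    ext z
    obtain ⟨w, rfl⟩ := (insertPlace r π v).surjective z
    rw [insertPlace_mem_liftSet_iff, h, insertPlace_mem_liftSet_iff]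
  have hl (i) : liftLetter r π v i = liftLetter r π' v i := by
    rw [← insertPlace_succAbove, h, insertPlace_succAbove]
  ext1 i
  have hi : Lifted r π v i ↔ Lifted r π' v i := by
    rw [← liftLetter_mem_iff, ← liftLetter_mem_iff, hT, hl]
  have hli := hl i
  by_cases h1 : Lifted r π v i
  · have h2 := hi.1 h1
    rw [liftLetter_of_lifted h1, liftLetter_of_lifted h2, hT] at hli
    by_contra hne
    rcases lt_or_gt_of_ne hne with h' | h'
    · exact (nextLetter_lt_nextLetter ((castSucc_mem_liftSet r π' v i).2 h2) h').ne hli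
    · refine (nextLetter_lt_nextLetter ?_ h').ne' hli
      exact hT ▸ (castSucc_mem_liftSet r π v i).2 h1
  · rw [liftLetter_of_not_lifted h1, liftLetter_of_not_lifted (fun h => h1 (hi.2 h))] at hli
    exact Fin.castSucc_injective _ hli

end Injectivity

section Statistics

variable {N r : ℕ}

theorem sum_lt_and_le_eq (π : Equiv.Perm (Fin N)) (v : ℕ) :
    ∑ i : Fin N, (if v ≤ (i : ℕ) ∧ (π i : ℕ) < v then 1 else 0) =
      ∑ i : Fin N, (if (i : ℕ) < v ∧ v ≤ (π i : ℕ) then 1 else 0) := by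
  have h := Equiv.sum_comp π (fun i => if (i : ℕ) < v then 1 else 0)
  have e1 : ∑ i : Fin N, (if (π i : ℕ) < v then 1 else 0) =
      ∑ i : Fin N, (if (i : ℕ) < v ∧ (π i : ℕ) < v then 1 else 0) +
      ∑ i : Fin N, (if v ≤ (i : ℕ) ∧ (π i : ℕ) < v then 1 else 0) := by
    rw [← Finset.sum_add_distrib]
    exact Finset.sum_congr rfl fun i _ => by split_ifs <;> omega
  have e2 : ∑ i : Fin N, (if (i : ℕ) < v then 1 else 0) =
      ∑ i : Fin N, (if (i : ℕ) < v ∧ (π i : ℕ) < v then 1 else 0) +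
      ∑ i : Fin N, (if (i : ℕ) < v ∧ v ≤ (π i : ℕ) then 1 else 0) := by
    rw [← Finset.sum_add_distrib]
    exact Finset.sum_congr rfl fun i _ => by split_ifs <;> omega
  omega

/-- The increase of the `r`-level Denert statistic caused by `insertPlace r π v`. -/
def insertGain (r : ℕ) (π : Equiv.Perm (Fin N)) (v : Fin (N + 1)) : ℕ :=
  ∑ i, (if Lifted r π v i then 1 else 0) + if newLetter r π v = v then 0 else (v : ℕ) + 1

theorem liftLetter_lt_liftLetter {π : Equiv.Perm (Fin N)} {v : Fin (N + 1)} {i j : Fin N}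
    (h : LevelExc r π i ↔ LevelExc r π j) :
    liftLetter r π v j < liftLetter r π v i ↔ π j < π i := by
  by_cases hi : Lifted r π v i <;> by_cases hj : Lifted r π v j
  · rw [liftLetter_of_lifted hi, liftLetter_of_lifted hj]
    refine ⟨fun h => ?_, nextLetter_lt_nextLetter ((castSucc_mem_liftSet r π v i).2 hi)⟩
    by_contra hc
    rcases eq_or_lt_of_le (not_lt.1 hc) with h' | h'
    · rw [h'] at h; exact lt_irrefl _ h
    · exact lt_asymm h (nextLetter_lt_nextLetter ((castSucc_mem_liftSet r π v j).2 hj) h')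
  · have h1 : (π j).castSucc < v := not_le.1 fun hv => hj ⟨h.1 hi.1, hv⟩
    have h2 := h1.trans_le hi.2
    rw [liftLetter_of_lifted hi, liftLetter_of_not_lifted hj]
    exact iff_of_true (h2.trans (castSucc_lt_nextLetter _ _)) (by simpa using h2)
  · have h1 : (π i).castSucc < v := not_le.1 fun hv => hi ⟨h.2 hj.1, hv⟩
    have h2 := h1.trans_le hj.2
    rw [liftLetter_of_lifted hj, liftLetter_of_not_lifted hi]
    exact iff_of_false (lt_asymm (h2.trans (castSucc_lt_nextLetter _ _)))
      (lt_asymm (by simpa using h2))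
  · rw [liftLetter_of_not_lifted hi, liftLetter_of_not_lifted hj]
    simp

theorem denr_insertPlace (hr : r ≤ N + 1) (π : Equiv.Perm (Fin N)) (v : Fin (N + 1)) :
    denr r (insertPlace r π v) = denr r π + insertGain r π v := by
  rw [denr_eq, denr_eq, insertGain]
  rw [Fin.sum_univ_succAbove _ v, Fin.sum_univ_succAbove _ v, Fin.sum_univ_succAbove _ v]
  simp only [Fin.sum_univ_succAbove _ v, levelExc_insertPlace_succAbove, insertPlace_same,
    insertPlace_succAbove, levelExc_insertPlace_same hr, lt_irrefl, false_and, if_false, zero_add,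
    Fin.succAbove_lt_succAbove_iff, Finset.sum_add_distrib]
  have hmain : ∑ i, ∑ j, (if i < j ∧ liftLetter r π v j < liftLetter r π v i ∧
      (LevelExc r π i ↔ LevelExc r π j) then 1 else 0) =
      ∑ i, ∑ j, (if i < j ∧ π j < π i ∧ (LevelExc r π i ↔ LevelExc r π j) then 1 else 0) := by
    refine Finset.sum_congr rfl fun i _ => Finset.sum_congr rfl fun j _ => ?_
    congr 1
    rw [eq_iff_iff]
    exact and_congr_right fun _ => and_congr_left fun h => liftLetter_lt_liftLetter h
  have hplace : ∑ i, (if LevelExc r π i then (v.succAbove i : ℕ) + 1 else 0) =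
      ∑ i, (if LevelExc r π i then (i : ℕ) + 1 else 0) +
      ∑ i, (if LevelExc r π i ∧ (v : ℕ) ≤ i then 1 else 0) := by
    rw [← Finset.sum_add_distrib]
    refine Finset.sum_congr rfl fun i _ => ?_
    rw [succAbove_val]
    split_ifs <;> simp_all
    omega
  rw [hmain, hplace]
  have hve := le_of_mem_liftSet r π v (newLetter_mem r π v)
  have hle := level_of_mem_liftSet r π v hr (newLetter_mem r π v)
  suffices H : (if v < newLetter r π v then (v : ℕ) + 1 else 0) +
      ∑ i, (if LevelExc r π i ∧ (v : ℕ) ≤ i then 1 else 0) +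
      ∑ j, (if v < v.succAbove j ∧ liftLetter r π v j < newLetter r π v ∧
        (v < newLetter r π v ↔ LevelExc r π j) then 1 else 0) +
      ∑ i, (if v.succAbove i < v ∧ newLetter r π v < liftLetter r π v i ∧
        (LevelExc r π i ↔ v < newLetter r π v) then 1 else 0) =
      ∑ i, (if Lifted r π v i then 1 else 0) +
        if newLetter r π v = v then 0 else (v : ℕ) + 1 by omega
  rcases hve.eq_or_lt with he | he
  · rw [← he] at hle ⊢
    simp only [lt_irrefl, false_iff, iff_false, if_false, zero_add, if_true, add_zero]
    have hrow : ∑ j, (if v < v.succAbove j ∧ liftLetter r π v j < v ∧ ¬ LevelExc r π j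
        then 1 else 0) = ∑ j : Fin N, (if (v : ℕ) ≤ (j : ℕ) ∧ (π j : ℕ) < v then 1 else 0) := by
      refine Finset.sum_congr rfl fun j _ => ?_
      congr 1
      rw [eq_iff_iff]
      simp only [Fin.lt_def, succAbove_val]
      by_cases hj : LevelExc r π j
      · simp only [hj, not_true, and_false, false_iff]
        have := hj.1
        omega
      · rw [liftLetter_of_not_lifted fun h => hj h.1, Fin.val_castSucc]
        simp only [hj, not_false_eq_true, and_true]
        split_ifs <;> omega
    rw [hrow, sum_lt_and_le_eq, ← Finset.sum_add_distrib, ← Finset.sum_add_distrib]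
    refine Finset.sum_congr rfl fun i _ => ?_
    have h3 : ¬ (v.succAbove i < v ∧ v < liftLetter r π v i ∧ ¬ LevelExc r π i) := by
      rintro ⟨h1, h2, h3⟩
      rw [liftLetter_of_not_lifted fun h => h3 h.1] at h2
      rw [Fin.lt_def, succAbove_val] at h1
      rw [Fin.lt_def, Fin.val_castSucc] at h2
      refine h3 ⟨?_, ?_⟩
      · split_ifs at h1 <;> omega
      · omega
    rw [if_neg h3]
    have h4 : Lifted r π v i ↔ LevelExc r π i ∧ (v : ℕ) ≤ i ∨ (i : ℕ) < v ∧ (v : ℕ) ≤ π i := by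
      simp only [Lifted, LevelExc, Fin.le_def, Fin.val_castSucc]
      omega
    by_cases h5 : (v : ℕ) ≤ i <;> simp [h4, h5, not_lt.2, not_le.1]
  · simp only [he, if_true, true_iff, iff_true, he.ne', if_false]
    have hrow : ∑ j, (if v < v.succAbove j ∧ liftLetter r π v j < newLetter r π v ∧
        LevelExc r π j then 1 else 0) = 0 := by
      refine Finset.sum_eq_zero fun j _ => if_neg ?_
      rintro ⟨h1, h2, h3⟩
      rw [Fin.lt_def, succAbove_val] at h1
      have hj : Lifted r π v j := by
        refine ⟨h3, ?_⟩
        have := h3.1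
        rw [Fin.le_def, Fin.val_castSucc]
        split_ifs at h1 <;> omega
      exact lt_asymm h2 (newLetter_lt_liftLetter hj)
    have hcol : ∑ i, (if Lifted r π v i then 1 else 0) =
        ∑ i, (if LevelExc r π i ∧ (v : ℕ) ≤ i then 1 else 0) +
        ∑ i, (if v.succAbove i < v ∧ newLetter r π v < liftLetter r π v i ∧
          LevelExc r π i then 1 else 0) := by
      rw [← Finset.sum_add_distrib]
      refine Finset.sum_congr rfl fun i _ => ?_
      simp only [Fin.lt_def (a := v.succAbove i), succAbove_val]
      by_cases hi : Lifted r π v i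
      · have h1 := newLetter_lt_liftLetter hi
        simp only [hi, hi.1, h1, true_and, and_true, if_true]
        split_ifs <;> omega
      · have h1 : LevelExc r π i → (π i : ℕ) < v := fun h =>
          not_le.1 fun hv => hi ⟨h, hv⟩
        simp only [hi, liftLetter_of_not_lifted hi, if_false, Fin.lt_def, Fin.val_castSucc]
        rw [Fin.lt_def] at he
        by_cases h2 : LevelExc r π i
        · have h3 := h1 h2
          have h4 := h2.1
          split_ifs <;> omega
        · simp [h2]
    omega

theorem excr_insertPlace (hr : r ≤ N + 1) (π : Equiv.Perm (Fin N)) (v : Fin (N + 1)) :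
    excr r (insertPlace r π v) =
      ∑ i, (if LevelExc r π i ∧ r ≤ (v.succAbove i : ℕ) + 1 then 1 else 0) +
        if v < newLetter r π v ∧ r ≤ (v : ℕ) + 1 then 1 else 0 := by
  rw [excr_eq, Fin.sum_univ_succAbove _ v, add_comm]
  simp only [levelExc_insertPlace_succAbove, levelExc_insertPlace_same hr]

theorem excr_insertPlace_of_le (hr : r ≤ N + 1) (π : Equiv.Perm (Fin N)) {v : Fin (N + 1)}
    (hv : r ≤ (v : ℕ) + 1) :
    excr r (insertPlace r π v) = excr r π + if v < newLetter r π v then 1 else 0 := by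
  rw [excr_insertPlace hr, excr_eq]
  simp only [hv, and_true]
  congr 1
  refine Finset.sum_congr rfl fun i _ => ?_
  rw [succAbove_val]
  congr 2
  rw [eq_iff_iff]
  split_ifs <;> omega

theorem excr_insertPlace_of_lt (hr : r ≤ N + 1) (π : Equiv.Perm (Fin N)) {v : Fin (N + 1)}
    (hv : (v : ℕ) + 1 < r) {l : Fin N} (hl : (l : ℕ) + 2 = r) :
    excr r (insertPlace r π v) = excr r π + if LevelExc r π l then 1 else 0 := by
  have hsum : (if LevelExc r π l then 1 else 0) =
      ∑ i, if i = l then (if LevelExc r π i then 1 else 0) else 0 := by simp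
  rw [excr_insertPlace hr, excr_eq, if_neg (by omega), add_zero, hsum, ← Finset.sum_add_distrib]
  refine Finset.sum_congr rfl fun i _ => ?_
  rw [succAbove_val]
  by_cases h : LevelExc r π i
  · simp only [h, true_and, if_true, Fin.ext_iff]
    split_ifs <;> omega
  · simp [h]

end Statistics

section Gain

variable {N r : ℕ}

theorem sum_mem_Ico_le (π : Equiv.Perm (Fin N)) (a b : ℕ) :
    ∑ i, (if a ≤ (π i : ℕ) ∧ (π i : ℕ) < b then 1 else 0) ≤ b - a := by
  rw [Equiv.sum_comp π (fun i => if a ≤ (i : ℕ) ∧ (i : ℕ) < b then 1 else 0),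
    ← Finset.card_filter, ← Nat.card_Ico]
  exact Finset.card_le_card_of_injOn (fun i => (i : ℕ)) (fun i hi => by simpa using hi)
    (fun i _ j _ h => Fin.ext h)

/-- The number of `r`-level excedance letters. -/
def numExc (r : ℕ) (π : Equiv.Perm (Fin N)) : ℕ := ∑ i, if LevelExc r π i then 1 else 0

/-- The number of `r`-level excedance letters that are at least `v`. -/
def numLifted (r : ℕ) (π : Equiv.Perm (Fin N)) (v : Fin (N + 1)) : ℕ :=
  ∑ i, if Lifted r π v i then 1 else 0

theorem insertGain_of_eq {π : Equiv.Perm (Fin N)} {v : Fin (N + 1)} (h : newLetter r π v = v) :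
    insertGain r π v = numLifted r π v := by simp [insertGain, h, numLifted]

theorem insertGain_of_lt {π : Equiv.Perm (Fin N)} {v : Fin (N + 1)} (h : v < newLetter r π v) :
    insertGain r π v = numLifted r π v + (v + 1) := by simp [insertGain, h.ne', numLifted]

theorem newLetter_eq_or_lt (r : ℕ) (π : Equiv.Perm (Fin N)) (v : Fin (N + 1)) :
    newLetter r π v = v ∨ v < newLetter r π v :=
  (le_of_mem_liftSet r π v (newLetter_mem r π v)).eq_or_lt.imp_left Eq.symm

theorem val_ne_of_lt_newLetter {π : Equiv.Perm (Fin N)} {v : Fin (N + 1)}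
    (h : v < newLetter r π v) {i : Fin N} (hi : LevelExc r π i) : (π i : ℕ) ≠ v := by
  intro hv
  have hv' : (π i).castSucc = v := Fin.ext hv
  have := newLetter_le r π v ((castSucc_mem_liftSet r π v i).2 ⟨hi, hv'.ge⟩)
  exact absurd h (not_lt.2 (this.trans hv'.le))

theorem numLifted_le_numExc (π : Equiv.Perm (Fin N)) (v : Fin (N + 1)) :
    numLifted r π v ≤ numExc r π := by
  refine Finset.sum_le_sum fun i _ => ?_
  by_cases h : Lifted r π v i
  · simp [h, h.1]
  · simp [h]

theorem numExc_le (π : Equiv.Perm (Fin N)) : numExc r π ≤ N := by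
  calc numExc r π ≤ ∑ _i : Fin N, 1 := Finset.sum_le_sum fun i _ => by split_ifs <;> simp
    _ = N := by simp

theorem numLifted_le_add {π : Equiv.Perm (Fin N)} {v w : Fin (N + 1)} {a : ℕ}
    (h : ∀ i, Lifted r π v i → Lifted r π w i ∨ a ≤ (π i : ℕ) ∧ (π i : ℕ) < w) :
    numLifted r π v ≤ numLifted r π w + (w - a) := by
  refine le_trans ?_ (Nat.add_le_add_left (sum_mem_Ico_le π a w) _)
  rw [numLifted, numLifted, ← Finset.sum_add_distrib]
  refine Finset.sum_le_sum fun i _ => ?_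
  have := h i
  split_ifs <;> simp_all

theorem lifted_or_lt {π : Equiv.Perm (Fin N)} (w : Fin (N + 1)) {i : Fin N}
    (h : LevelExc r π i) : Lifted r π w i ∨ (π i : ℕ) < w :=
  (le_or_gt w (π i).castSucc).imp (fun h' => ⟨h, h'⟩) id

theorem insertGain_lt (π : Equiv.Perm (Fin N)) (v : Fin (N + 1)) : insertGain r π v < N + 1 := by
  rcases newLetter_eq_or_lt r π v with h | h
  · rw [insertGain_of_eq h]
    exact Nat.lt_succ_of_le ((numLifted_le_numExc π v).trans (numExc_le π))
  · rw [insertGain_of_lt h]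
    have hz : numLifted r π (Fin.last N) = 0 := by
      refine Finset.sum_eq_zero fun i _ => if_neg fun hi => ?_
      exact absurd (Fin.castSucc_lt_last (π i)) (not_lt.2 hi.2)
    have := numLifted_le_add (r := r) (π := π) (v := v) (w := Fin.last N) (a := v + 1)
      fun i hi => .inr ⟨?_, by simp⟩
    · have hv := h.trans_le (Fin.le_last _)
      rw [Fin.lt_def, Fin.val_last] at hv
      rw [hz, Fin.val_last] at this
      omega
    · have := val_ne_of_lt_newLetter h hi.1
      have h2 := hi.2
      rw [Fin.le_def, Fin.val_castSucc] at h2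
      omega

theorem insertGain_le_of_eq {π : Equiv.Perm (Fin N)} {v : Fin (N + 1)}
    (h : newLetter r π v = v) : insertGain r π v ≤ numExc r π :=
  (insertGain_of_eq h).trans_le (numLifted_le_numExc π v)

theorem lt_newLetter_of_lt (hr : r ≤ N + 1) (π : Equiv.Perm (Fin N)) {v : Fin (N + 1)}
    (hv : (v : ℕ) + 1 < r) : v < newLetter r π v := by
  have := level_of_mem_liftSet r π v hr (newLetter_mem r π v)
  rw [Fin.lt_def]
  omega

theorem insertGain_of_val_lt (hr : r ≤ N + 1) (π : Equiv.Perm (Fin N)) {v : Fin (N + 1)}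
    (hv : (v : ℕ) + 1 < r) : insertGain r π v = numExc r π + (v + 1) := by
  rw [insertGain_of_lt (lt_newLetter_of_lt hr π hv)]
  congr 1
  refine Finset.sum_congr rfl fun i _ => ?_
  congr 1
  simp only [Lifted, LevelExc, Fin.le_def, Fin.val_castSucc, eq_iff_iff]
  omega

theorem numExc_lt_insertGain {π : Equiv.Perm (Fin N)} {v : Fin (N + 1)}
    (h : v < newLetter r π v) : numExc r π < insertGain r π v := by
  rw [insertGain_of_lt h]
  have hz : numLifted r π 0 = numExc r π := by simp [numLifted, numExc, Lifted]
  have := numLifted_le_add (r := r) (π := π) (v := 0) (w := v) (a := 0)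
    fun i hi => (lifted_or_lt v hi.1).imp_right fun h' => ⟨Nat.zero_le _, h'⟩
  omega

theorem numExc_add_le_insertGain {π : Equiv.Perm (Fin N)} {v : Fin (N + 1)}
    (h : v < newLetter r π v) (hv : r ≤ (v : ℕ) + 1) :
    numExc r π + r ≤ insertGain r π v := by
  rw [insertGain_of_lt h]
  have hz : numLifted r π 0 = numExc r π := by simp [numLifted, numExc, Lifted]
  have := numLifted_le_add (r := r) (π := π) (v := 0) (w := v) (a := r - 1)
    fun i hi => (lifted_or_lt v hi.1).imp_right fun h' => ⟨by have := hi.1.2; omega, h'⟩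
  omega

theorem insertGain_ne_of_lt {π : Equiv.Perm (Fin N)} {v w : Fin (N + 1)} (hvw : v < w) :
    insertGain r π v ≠ insertGain r π w := by
  rcases newLetter_eq_or_lt r π v with h | h <;> rcases newLetter_eq_or_lt r π w with h' | h'
  · rw [insertGain_of_eq h, insertGain_of_eq h']
    refine (ne_of_lt ?_).symm
    have hmem := h ▸ newLetter_mem r π v
    simp only [liftSet, mem_insert, mem_image, mem_filter, mem_univ, true_and] at hmem
    obtain rfl | ⟨i, hi, hiv⟩ := hmem
    · exact absurd hvw (not_lt.2 (Fin.le_last w))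
    · refine Finset.sum_lt_sum (fun j _ => ?_) ⟨i, mem_univ _, ?_⟩
      · by_cases hj : Lifted r π w j
        · have : Lifted r π v j := ⟨hj.1, hvw.le.trans hj.2⟩
          simp [hj, this]
        · simp [hj]
      · have : ¬ Lifted r π w i := fun hw => absurd hvw (not_lt.2 (hw.2.trans hiv.le))
        simp [hi, this]
  · exact ((insertGain_le_of_eq h).trans_lt (numExc_lt_insertGain h')).ne
  · exact ((insertGain_le_of_eq h').trans_lt (numExc_lt_insertGain h)).ne'
  · rw [insertGain_of_lt h, insertGain_of_lt h']
    have := numLifted_le_add (r := r) (π := π) (v := v) (w := w) (a := v + 1) fun i hi =>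
      (lifted_or_lt w hi.1).imp_right fun hlt => ⟨?_, hlt⟩
    · rw [Fin.lt_def] at hvw
      omega
    · have h1 := val_ne_of_lt_newLetter h hi.1
      have h2 := hi.2
      rw [Fin.le_def, Fin.val_castSucc] at h2
      omega

/-- For fixed `π`, the gain takes every value exactly once. -/
noncomputable def gainPerm (r : ℕ) (π : Equiv.Perm (Fin N)) : Equiv.Perm (Fin (N + 1)) :=
  Equiv.ofBijective (fun v => ⟨insertGain r π v, insertGain_lt π v⟩)
    (Finite.injective_iff_bijective.1 fun v w h => by
      rw [Fin.mk.injEq] at h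
      rcases lt_trichotomy v w with h' | h' | h'
      · exact absurd h (insertGain_ne_of_lt h')
      · exact h'
      · exact absurd h.symm (insertGain_ne_of_lt h'))

@[simp] theorem gainPerm_apply (π : Equiv.Perm (Fin N)) (v : Fin (N + 1)) :
    (gainPerm r π v : ℕ) = insertGain r π v := rfl

end Gain

section Rank

variable {N : ℕ}

theorem card_filter_perm_lt (τ : Equiv.Perm (Fin N)) (x : Fin N) :
    (univ.filter fun j => τ j < x).card = x := by
  rw [Finset.card_filter, Equiv.sum_comp τ (fun j => if j < x then 1 else 0),
    ← Finset.card_filter, ← Fin.card_Iio x]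
  congr 1
  ext j
  simp

/-- The permutation sending each place to the rank of its letter in the injective word `W`. -/
noncomputable def rankPerm (W : Fin N → ℕ) (hW : Function.Injective W) : Equiv.Perm (Fin N) :=
  Equiv.ofBijective
    (fun i => ⟨(univ.filter fun j => W j < W i).card, by
      have := Finset.card_lt_card (s := univ.filter fun j => W j < W i) (t := univ)
        ⟨Finset.filter_subset _ _, fun h => lt_irrefl _ (mem_filter.1 (h (mem_univ i))).2⟩
      simpa using this⟩)
    (Finite.injective_iff_bijective.1 (by
      have key (i j) (h : W i < W j) : (univ.filter fun k => W k < W i).card <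
          (univ.filter fun k => W k < W j).card := by
        refine Finset.card_lt_card ⟨fun k hk => ?_, fun h' => ?_⟩
        · simp only [mem_filter, mem_univ, true_and] at hk ⊢
          exact hk.trans h
        · have := h' (show i ∈ _ by simpa using h)
          simp at this
      intro i j h
      rw [Fin.mk.injEq] at h
      rcases lt_trichotomy (W i) (W j) with h' | h' | h'
      · exact absurd h (key i j h').ne
      · exact hW h'
      · exact absurd h (key j i h').ne'))

theorem rankPerm_val (W : Fin N → ℕ) (hW : Function.Injective W) (i : Fin N) :
    (rankPerm W hW i : ℕ) = (univ.filter fun j => W j < W i).card := rfl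

theorem rankPerm_lt_iff (W : Fin N → ℕ) (hW : Function.Injective W) (i j : Fin N) :
    rankPerm W hW i < rankPerm W hW j ↔ W i < W j := by
  have key (i j) (h : W i < W j) : rankPerm W hW i < rankPerm W hW j := by
    rw [Fin.lt_def, rankPerm_val, rankPerm_val]
    refine Finset.card_lt_card ⟨fun k hk => ?_, fun h' => ?_⟩
    · simp only [mem_filter, mem_univ, true_and] at hk ⊢
      exact hk.trans h
    · have := h' (show i ∈ _ by simpa using h)
      simp at this
  refine ⟨fun h => ?_, key i j⟩
  rcases lt_trichotomy (W i) (W j) with h' | h' | h'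
  · exact h'
  · exact absurd h (by rw [hW h']; exact lt_irrefl _)
  · exact absurd h (lt_asymm (key j i h'))

theorem eq_rankPerm {W : Fin N → ℕ} {hW : Function.Injective W} {τ : Equiv.Perm (Fin N)}
    (h : ∀ i j, τ i < τ j ↔ W i < W j) : rankPerm W hW = τ := by
  ext i
  rw [rankPerm_val, ← card_filter_perm_lt τ (τ i)]
  simp only [h]

/-- Move `h` to `g`, shifting the elements in between by one. -/
def moveFun (h g x : Fin N) : Fin N :=
  if x = h then g
  else if h < x ∧ x ≤ g then ⟨x - 1, by omega⟩
  else if hx : g ≤ x ∧ x < h then ⟨x + 1, by have := hx.2; rw [Fin.lt_def] at this; omega⟩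
  else x

theorem moveFun_val (h g x : Fin N) : (moveFun h g x : ℕ) =
    if (x : ℕ) = h then (g : ℕ) else if (h : ℕ) < x ∧ (x : ℕ) ≤ g then (x : ℕ) - 1
    else if (g : ℕ) ≤ x ∧ (x : ℕ) < h then (x : ℕ) + 1 else x := by
  simp only [moveFun, Fin.ext_iff, Fin.lt_def, Fin.le_def]
  split_ifs <;> rfl

theorem moveFun_moveFun (h g x : Fin N) : moveFun g h (moveFun h g x) = x := by
  rw [Fin.ext_iff, moveFun_val, moveFun_val]
  split_ifs <;> omega

/-- `moveFun` as a permutation. -/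
def movePerm (h g : Fin N) : Equiv.Perm (Fin N) :=
  ⟨moveFun h g, moveFun g h, moveFun_moveFun h g, moveFun_moveFun g h⟩

theorem movePerm_mul_movePerm (h g : Fin N) : movePerm g h * movePerm h g = 1 :=
  Equiv.ext fun x => moveFun_moveFun h g x

theorem movePerm_self (h g : Fin N) : movePerm h g h = g := if_pos rfl

theorem movePerm_val (h g x : Fin N) : (movePerm h g x : ℕ) =
    if (x : ℕ) = h then (g : ℕ) else if (h : ℕ) < x ∧ (x : ℕ) ≤ g then (x : ℕ) - 1
    else if (g : ℕ) ≤ x ∧ (x : ℕ) < h then (x : ℕ) + 1 else x := moveFun_val h g x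

theorem movePerm_lt_iff {h g x y : Fin N} (hx : x ≠ h) (hy : y ≠ h) :
    movePerm h g x < movePerm h g y ↔ x < y := by
  rw [Fin.lt_def, Fin.lt_def, movePerm_val, movePerm_val]
  rw [Ne, Fin.ext_iff] at hx hy
  split_ifs <;> omega

end Rank

section Rearrangement

variable {N : ℕ} (r : ℕ) (π : Equiv.Perm (Fin N))

/-- Sorting key: on the places below the level, the letters that are at least `r` come before
the smaller ones; the remaining places are left in their order. -/
def levelKey (i : Fin N) : ℕ :=
  if r ≤ (i : ℕ) + 1 then 2 * N + i else if r ≤ (π i : ℕ) + 1 then (π i : ℕ) else N + π i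

theorem levelKey_injective : Function.Injective (levelKey r π) := by
  intro i j h
  have h1 : (π i : ℕ) = π j → i = j := fun h => π.injective (Fin.ext h)
  have h2 := (π i).isLt
  have h3 := (π j).isLt
  simp only [levelKey] at h
  split_ifs at h <;> first | exact h1 (by omega) | omega

/-- The ranks of the places with respect to `levelKey`. -/
noncomputable def levelRank : Equiv.Perm (Fin N) := rankPerm _ (levelKey_injective r π)

theorem levelRank_lt_iff (i j : Fin N) :
    levelRank r π i < levelRank r π j ↔ levelKey r π i < levelKey r π j :=
  rankPerm_lt_iff _ _ i j

/-- The place permutation which gives place `l` the rank `g` and keeps the relative order of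
the other letters. -/
noncomputable def placeMove (l g : Fin N) : Equiv.Perm (Fin N) :=
  (levelRank r π)⁻¹ * movePerm (levelRank r π l) g * levelRank r π

/-- Rearrange the letters below the level so that place `l` gets rank `g`. -/
noncomputable def setRank (l g : Fin N) : Equiv.Perm (Fin N) := π * placeMove r π l g

variable {r π} {l : Fin N}

theorem levelRank_of_lt (hl : (l : ℕ) + 2 = r) {i : Fin N} (hi : l < i) : levelRank r π i = i := by
  rw [Fin.ext_iff, levelRank, rankPerm_val]
  conv_rhs => rw [← Fin.card_Iio i]
  congr 1
  ext j
  have := (π j).isLt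
  rw [Fin.lt_def] at hi
  rw [mem_filter, mem_Iio, levelKey, levelKey, Fin.lt_def]
  simp only [mem_univ, true_and]
  split_ifs <;> omega

theorem levelRank_le_iff (hl : (l : ℕ) + 2 = r) {i : Fin N} : levelRank r π i ≤ l ↔ i ≤ l := by
  rcases le_or_gt i l with h | h
  · refine iff_of_true ?_ h
    by_contra hc
    rw [not_le] at hc
    have := (levelRank r π).injective (levelRank_of_lt (π := π) hl hc)
    rw [this] at hc
    exact absurd h (not_le.2 hc)
  · rw [levelRank_of_lt hl h]

theorem placeMove_of_lt (hl : (l : ℕ) + 2 = r) {g i : Fin N} (hg : g ≤ l)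
    (hi : l < i) : placeMove r π l g i = i := by
  simp only [placeMove, Equiv.Perm.mul_apply]
  rw [Equiv.Perm.inv_eq_iff_eq, levelRank_of_lt hl hi]
  have := (levelRank_le_iff (π := π) hl).2 (le_refl l)
  rw [Fin.ext_iff, movePerm_val]
  rw [Fin.le_def] at this hg
  rw [Fin.lt_def] at hi
  split_ifs <;> omega

theorem placeMove_le_iff (hl : (l : ℕ) + 2 = r) {g i : Fin N} (hg : g ≤ l) :
    placeMove r π l g i ≤ l ↔ i ≤ l := by
  rcases le_or_gt i l with h | h
  · refine iff_of_true ?_ h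
    by_contra hc
    rw [not_le] at hc
    have := (placeMove r π l g).injective (placeMove_of_lt (π := π) hl hg hc)
    rw [this] at hc
    exact absurd h (not_le.2 hc)
  · rw [placeMove_of_lt hl hg h]

theorem levelExc_setRank (hl : (l : ℕ) + 2 = r) {g : Fin N} (hg : g ≤ l) (i : Fin N) :
    LevelExc r (setRank r π l g) i ↔ LevelExc r π (placeMove r π l g i) := by
  rcases le_or_gt i l with h | h
  · have h' := (placeMove_le_iff (π := π) hl hg).2 h
    rw [Fin.le_def] at h h'
    simp only [LevelExc, setRank, Equiv.Perm.mul_apply]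
    omega
  · simp only [LevelExc, setRank, Equiv.Perm.mul_apply, placeMove_of_lt hl hg h]

theorem levelKey_setRank (hl : (l : ℕ) + 2 = r) {g : Fin N} (hg : g ≤ l) (i : Fin N) :
    levelKey r (setRank r π l g) i = levelKey r π (placeMove r π l g i) := by
  rcases le_or_gt i l with h | h
  · have h' := (placeMove_le_iff (π := π) hl hg).2 h
    rw [Fin.le_def] at h h'
    simp only [levelKey, setRank, Equiv.Perm.mul_apply]
    rw [if_neg (by omega), if_neg (by omega : ¬ r ≤ (placeMove r π l g i : ℕ) + 1)]
    rfl
  · simp only [levelKey, setRank, Equiv.Perm.mul_apply, placeMove_of_lt hl hg h]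

theorem levelRank_setRank (hl : (l : ℕ) + 2 = r) {g : Fin N} (hg : g ≤ l) :
    levelRank r (setRank r π l g) = movePerm (levelRank r π l) g * levelRank r π := by
  refine eq_rankPerm fun i j => ?_
  rw [levelKey_setRank hl hg, levelKey_setRank hl hg, ← levelRank_lt_iff]
  simp [placeMove]

theorem levelRank_setRank_self (hl : (l : ℕ) + 2 = r) {g : Fin N} (hg : g ≤ l) :
    levelRank r (setRank r π l g) l = g := by
  rw [levelRank_setRank hl hg, Equiv.Perm.mul_apply, movePerm_self]

theorem setRank_setRank (hl : (l : ℕ) + 2 = r) {g : Fin N} (hg : g ≤ l) :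
    setRank r (setRank r π l g) l (levelRank r π l) = π := by
  have h := movePerm_mul_movePerm (levelRank r π l) g
  rw [setRank, placeMove, levelRank_setRank_self hl hg, levelRank_setRank hl hg,
    setRank, placeMove, eq_inv_of_mul_eq_one_left h]
  group

theorem numExc_setRank (hl : (l : ℕ) + 2 = r) {g : Fin N} (hg : g ≤ l) :
    numExc r (setRank r π l g) = numExc r π := by
  simp only [numExc, levelExc_setRank hl hg]
  exact Equiv.sum_comp (placeMove r π l g) (fun i => if LevelExc r π i then 1 else 0)

theorem excr_setRank (hl : (l : ℕ) + 2 = r) {g : Fin N} (hg : g ≤ l) :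
    excr r (setRank r π l g) = excr r π := by
  rw [excr_eq, excr_eq,
    ← Equiv.sum_comp (placeMove r π l g)
      (fun i => if LevelExc r π i ∧ r ≤ (i : ℕ) + 1 then 1 else 0)]
  refine Finset.sum_congr rfl fun i _ => ?_
  have := placeMove_le_iff (π := π) (i := i) hl hg
  rw [Fin.le_def, Fin.le_def] at this
  congr 1
  rw [levelExc_setRank hl hg, eq_iff_iff]
  exact and_congr_right fun _ => by omega

theorem levelExc_iff_levelRank_lt (hl : (l : ℕ) + 2 = r) :
    LevelExc r π l ↔ (levelRank r π l : ℕ) + excr r π < numExc r π := by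
  have hb : numExc r π = excr r π + (univ.filter fun i => i ≤ l ∧ LevelExc r π i).card := by
    rw [numExc, excr_eq, Finset.card_filter, ← Finset.sum_add_distrib]
    refine Finset.sum_congr rfl fun i _ => ?_
    by_cases h : LevelExc r π i
    · simp only [h, true_and, and_true, if_true, Fin.le_def]
      split_ifs <;> omega
    · simp [h]
  rw [hb, add_comm, Nat.add_lt_add_iff_left, levelRank, rankPerm_val]
  have hk (j : Fin N) := (π j).isLt
  by_cases h : LevelExc r π l
  · refine iff_of_true h (Finset.card_lt_card ⟨fun j hj => ?_, fun h' => ?_⟩)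
    · simp only [mem_filter, mem_univ, true_and] at hj ⊢
      rw [levelKey, levelKey] at hj
      have := hk j; have := hk l
      have := h.2
      rw [if_neg (by omega : ¬ r ≤ (l : ℕ) + 1), if_pos this] at hj
      rw [Fin.le_def, LevelExc]
      split_ifs at hj <;> omega
    · have := h' (show l ∈ _ by simpa using h)
      simp at this
  · refine iff_of_false h (not_lt.2 (Finset.card_le_card fun j hj => ?_))
    simp only [mem_filter, mem_univ, true_and] at hj ⊢
    rw [levelKey, levelKey]
    simp only [LevelExc, Fin.le_def] at hj h
    have := hk j; have := hk l
    split_ifs <;> omega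

end Rearrangement

section Denert

variable {N : ℕ} {r : ℕ} {π : Equiv.Perm (Fin N)} {l : Fin N}

theorem sum_card_filter_le (S : Finset (Fin N)) :
    ∑ j ∈ S, (S.filter fun i => i ≤ j).card = ∑ t ∈ range S.card, (t + 1) := by
  induction S using Finset.induction_on_max with
  | empty => simp
  | insert a s h ih =>
    have ha : a ∉ s := fun h' => lt_irrefl _ (h a h')
    rw [Finset.sum_insert ha, Finset.card_insert_of_notMem ha, Finset.sum_range_succ, ← ih,
      add_comm]
    congr 1
    · refine Finset.sum_congr rfl fun j hj => ?_
      rw [Finset.filter_insert, if_neg (not_le.2 (h j hj))]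
    · rw [← Finset.card_insert_of_notMem ha, Finset.filter_true_of_mem]
      intro i hi
      rcases Finset.mem_insert.1 hi with rfl | hi
      · exact le_rfl
      · exact (h i hi).le

/-- The contribution of the pairs whose right end is the place `j` and of `j` itself to `denr`. -/
noncomputable def denrAt (r : ℕ) (π : Equiv.Perm (Fin N)) (j : Fin N) : ℕ :=
  (∑ i, if i < j ∧ π j < π i ∧ (LevelExc r π i ↔ LevelExc r π j) then 1 else 0) +
    if LevelExc r π j then (j : ℕ) + 1 else 0

theorem denr_eq_sum_denrAt : denr r π = ∑ j, denrAt r π j := by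
  rw [denr_eq, Finset.sum_comm, add_comm, ← Finset.sum_add_distrib]
  rfl

theorem levelExc_iff_of_le (hl : (l : ℕ) + 2 = r) {i : Fin N} (hi : i ≤ l) :
    LevelExc r π i ↔ r ≤ (π i : ℕ) + 1 := by
  rw [Fin.le_def] at hi
  rw [LevelExc]
  omega

theorem denrAt_of_le (hl : (l : ℕ) + 2 = r) {j : Fin N} (hj : j ≤ l) :
    denrAt r π j = (∑ i, if i < j ∧ levelRank r π j < levelRank r π i then 1 else 0) +
      ∑ i, if LevelExc r π j ∧ LevelExc r π i ∧ i ≤ j then 1 else 0 := by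
  have hE : (if LevelExc r π j then (j : ℕ) + 1 else 0) =
      ∑ i, if LevelExc r π j ∧ i ≤ j then 1 else 0 := by
    split_ifs with h
    · rw [← Fin.card_Iic, ← Finset.card_filter]
      congr 1
      ext i
      simp [h]
    · simp [h]
  rw [denrAt, hE, ← Finset.sum_add_distrib, ← Finset.sum_add_distrib]
  refine Finset.sum_congr rfl fun i _ => ?_
  rcases lt_trichotomy i j with hij | rfl | hij
  · have hil := hij.le.trans hj
    have hk := levelRank_lt_iff r π j i
    have hej := levelExc_iff_of_le (π := π) hl hj
    have hei := levelExc_iff_of_le (π := π) hl hil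
    rw [Fin.le_def] at hj hil
    have := (π i).isLt
    have := (π j).isLt
    rw [levelKey, levelKey, if_neg (by omega : ¬ r ≤ (j : ℕ) + 1),
      if_neg (by omega : ¬ r ≤ (i : ℕ) + 1)] at hk
    simp only [hk, hei, hej, hij, hij.le, true_and, and_true, Fin.lt_def]
    by_cases hi' : r ≤ (π i : ℕ) + 1 <;> by_cases hj' : r ≤ (π j : ℕ) + 1 <;>
      simp only [hi', hj', and_true, if_true, if_false, and_false, iff_false,
        false_iff, not_true, Nat.add_lt_add_iff_left] <;>
      split_ifs <;> omega
  · simp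
  · simp [not_lt.2 hij.le, not_le.2 hij]

theorem denr_eq_of_level (hl : (l : ℕ) + 2 = r) : denr r π =
    (∑ j, ∑ i, if j ≤ l ∧ i < j ∧ levelRank r π j < levelRank r π i then 1 else 0) +
      ∑ t ∈ range (univ.filter fun i => i ≤ l ∧ LevelExc r π i).card, (t + 1) +
      ∑ j, if l < j then denrAt r π j else 0 := by
  rw [denr_eq_sum_denrAt, ← sum_card_filter_le, Finset.sum_filter, ← Finset.sum_add_distrib,
    ← Finset.sum_add_distrib]
  refine Finset.sum_congr rfl fun j _ => ?_
  rcases le_or_gt j l with h | h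
  · rw [denrAt_of_le hl h, if_neg (not_lt.2 h), add_zero]
    simp only [h, true_and]
    congr 1
    split_ifs with hj
    · rw [Finset.filter_filter, Finset.card_filter]
      refine Finset.sum_congr rfl fun i _ => ?_
      congr 1
      rw [eq_iff_iff]
      exact ⟨fun h' => ⟨⟨h'.2.2.trans h, h'.2.1⟩, h'.2.2⟩, fun h' => ⟨hj, h'.1.2, h'.2⟩⟩
    · simp [hj]
  · simp [h, not_le.2 h]

theorem sum_levelRank_lt (hl : (l : ℕ) + 2 = r) :
    (∑ i, if i < l ∧ levelRank r π l < levelRank r π i then 1 else 0) + (levelRank r π l : ℕ) =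
      l := by
  have h := card_filter_perm_lt (levelRank r π) (levelRank r π l)
  rw [← h, Finset.card_filter, ← Finset.sum_add_distrib]
  have h2 : (univ.filter fun i => i < l).card = (l : ℕ) := card_filter_perm_lt 1 l
  conv_rhs => rw [← h2, Finset.card_filter]
  refine Finset.sum_congr rfl fun i _ => ?_
  rcases lt_trichotomy i l with hi | rfl | hi
  · rcases lt_trichotomy (levelRank r π i) (levelRank r π l) with h' | h' | h'
    · simp [hi, h', h'.le]
    · exact absurd ((levelRank r π).injective h') hi.ne
    · simp [hi, h', h'.le]
  · simp
  · have : levelRank r π l < levelRank r π i := by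
      rw [levelRank_of_lt hl hi]
      exact ((levelRank_le_iff hl).2 le_rfl).trans_lt hi
    simp [not_lt.2 hi.le, not_lt.2 this.le]

theorem sum_levelRank_inv (hl : (l : ℕ) + 2 = r) :
    (∑ j, ∑ i, if j ≤ l ∧ i < j ∧ levelRank r π j < levelRank r π i then 1 else 0) +
      (levelRank r π l : ℕ) =
    (∑ j, ∑ i, if j < l ∧ i < j ∧ levelRank r π j < levelRank r π i then 1 else 0) + l := by
  conv_rhs => rw [← sum_levelRank_lt (π := π) hl]
  rw [← add_assoc]
  congr 1
  have h2 : (∑ i, if i < l ∧ levelRank r π l < levelRank r π i then 1 else 0) =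
      ∑ j, if j = l then
        (∑ i, if i < l ∧ levelRank r π l < levelRank r π i then 1 else 0) else 0 := by simp
  rw [h2, ← Finset.sum_add_distrib]
  refine Finset.sum_congr rfl fun j _ => ?_
  rcases lt_trichotomy j l with h | rfl | h
  · simp [h, h.le, h.ne]
  · simp
  · simp [not_lt.2 h.le, not_le.2 h, h.ne']

theorem denrAt_setRank (hl : (l : ℕ) + 2 = r) {g j : Fin N} (hg : g ≤ l) (hj : l < j) :
    denrAt r (setRank r π l g) j = denrAt r π j := by
  have hρ := placeMove_of_lt (π := π) hl hg hj
  simp only [denrAt, levelExc_setRank hl hg, hρ]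
  congr 1
  rw [← Equiv.sum_comp (placeMove r π l g) (fun i =>
    if i < j ∧ π j < π i ∧ (LevelExc r π i ↔ LevelExc r π j) then 1 else 0)]
  refine Finset.sum_congr rfl fun i _ => ?_
  have hi : i < j ↔ placeMove r π l g i < j := by
    rcases le_or_gt i l with h | h
    · exact iff_of_true (h.trans_lt hj) (((placeMove_le_iff hl hg).2 h).trans_lt hj)
    · rw [placeMove_of_lt hl hg h]
  simp only [hi, setRank, Equiv.Perm.mul_apply, hρ]

/-- Changing the rank of the last place below the level changes `denr` accordingly. -/
theorem denr_setRank (hl : (l : ℕ) + 2 = r) {g : Fin N} (hg : g ≤ l) :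
    denr r (setRank r π l g) + g = denr r π + levelRank r π l := by
  have hB : (univ.filter fun i => i ≤ l ∧ LevelExc r (setRank r π l g) i).card =
      (univ.filter fun i => i ≤ l ∧ LevelExc r π i).card := by
    rw [Finset.card_filter, Finset.card_filter, ← Equiv.sum_comp (placeMove r π l g)
      (fun i => if i ≤ l ∧ LevelExc r π i then 1 else 0)]
    simp only [levelExc_setRank hl hg, placeMove_le_iff hl hg]
  have hR : (∑ j, if l < j then denrAt r (setRank r π l g) j else 0) =
      ∑ j, if l < j then denrAt r π j else 0 := by
    refine Finset.sum_congr rfl fun j _ => ?_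
    split_ifs with h
    · exact denrAt_setRank hl hg h
    · rfl
  have h1 := sum_levelRank_inv (π := setRank r π l g) hl
  have h2 := sum_levelRank_inv (π := π) hl
  have h3 : (∑ j, ∑ i, if j < l ∧ i < j ∧ levelRank r (setRank r π l g) j <
        levelRank r (setRank r π l g) i then 1 else 0) =
      ∑ j, ∑ i, if j < l ∧ i < j ∧ levelRank r π j < levelRank r π i then 1 else 0 := by
    refine Finset.sum_congr rfl fun j _ => Finset.sum_congr rfl fun i _ => ?_
    congr 1
    rw [eq_iff_iff]
    refine and_congr_right fun hj => and_congr_right fun hi => ?_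
    rw [levelRank_setRank hl hg, Equiv.Perm.mul_apply, Equiv.Perm.mul_apply, movePerm_lt_iff]
    · exact fun h => hj.ne ((levelRank r π).injective h)
    · exact fun h => (hi.trans hj).ne ((levelRank r π).injective h)
  rw [levelRank_setRank_self hl hg] at h1
  rw [denr_eq_of_level hl, denr_eq_of_level (π := π) hl, hB, hR]
  omega

end Denert

section Bijection

variable {N : ℕ} {r : ℕ}

/-- Below the level, exchange the insertion place with the reflected rank of the last place below
the level. -/
noncomputable def reflectRank (r : ℕ) (p : Equiv.Perm (Fin N) × Fin (N + 1)) :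
    Equiv.Perm (Fin N) × Fin (N + 1) :=
  if h : (p.2 : ℕ) + 1 < r ∧ r ≤ N + 1 then
    (setRank r p.1 ⟨r - 2, by omega⟩ ⟨r - 2 - p.2, by omega⟩,
      ⟨r - 2 - levelRank r p.1 ⟨r - 2, by omega⟩, by omega⟩)
  else p

theorem reflectRank_of_le {p : Equiv.Perm (Fin N) × Fin (N + 1)} (h : r ≤ (p.2 : ℕ) + 1) :
    reflectRank r p = p := dif_neg (by omega)

theorem reflectRank_of_lt {p : Equiv.Perm (Fin N) × Fin (N + 1)} {l g : Fin N}
    (hl : (l : ℕ) + 2 = r) (hg : (g : ℕ) + p.2 = l) :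
    (reflectRank r p).1 = setRank r p.1 l g ∧
      ((reflectRank r p).2 : ℕ) = l - levelRank r p.1 l := by
  have hl' : (⟨r - 2, by omega⟩ : Fin N) = l := Fin.ext (by simp only; omega)
  have hg' : (⟨r - 2 - p.2, by omega⟩ : Fin N) = g := Fin.ext (by simp only; omega)
  rw [reflectRank, dif_pos (by omega)]
  simp only [hl', hg', true_and]
  omega

theorem exists_level (hr : r ≤ N + 1) {v : Fin (N + 1)} (hv : (v : ℕ) + 1 < r) :
    ∃ l g : Fin N, (l : ℕ) + 2 = r ∧ (g : ℕ) + v = l :=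
  ⟨⟨r - 2, by omega⟩, ⟨r - 2 - v, by omega⟩, by simp only; omega, by simp only; omega⟩

theorem reflectRank_involutive (hr : r ≤ N + 1) :
    Function.Involutive (reflectRank (N := N) r) := by
  rintro ⟨π, v⟩
  rcases le_or_gt r ((v : ℕ) + 1) with hv | hv
  · rw [reflectRank_of_le (p := (π, v)) hv, reflectRank_of_le (p := (π, v)) hv]
  · obtain ⟨l, g, hl, hg⟩ := exists_level hr hv
    have hgl : g ≤ l := by rw [Fin.le_def]; omega
    have hτ : levelRank r π l ≤ l := (levelRank_le_iff hl).2 le_rfl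
    rw [Fin.le_def] at hτ
    obtain ⟨h1, h2⟩ := reflectRank_of_lt (p := (π, v)) hl hg
    obtain ⟨h3, h4⟩ := reflectRank_of_lt (p := reflectRank r (π, v)) (g := levelRank r π l) hl
      (by rw [h2]; simp only; omega)
    rw [h1] at h3 h4
    rw [levelRank_setRank_self hl hgl] at h4
    refine Prod.ext (h3.trans (setRank_setRank hl hgl)) (Fin.ext ?_)
    rw [h4]
    simp only
    omega

theorem excr_le_numExc (π : Equiv.Perm (Fin N)) : excr r π ≤ numExc r π := by
  rw [excr_eq, numExc]
  refine Finset.sum_le_sum fun i _ => ?_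
  split_ifs <;> tauto

theorem numExc_le_excr_add (π : Equiv.Perm (Fin N)) : numExc r π ≤ excr r π + (r - 1) := by
  have h : (∑ i : Fin N, if (i : ℕ) < r - 1 then 1 else 0) ≤ r - 1 := by
    rw [← Finset.card_filter]
    simpa using Finset.card_le_card_of_injOn (t := range (r - 1)) (fun i : Fin N => (i : ℕ))
      (fun i hi => by simpa using hi) (Fin.val_injective.injOn)
  refine le_trans ?_ (Nat.add_le_add_left h _)
  rw [excr_eq, numExc, ← Finset.sum_add_distrib]
  refine Finset.sum_le_sum fun i _ => ?_
  by_cases hi : LevelExc r π i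
  · simp only [hi, true_and, if_true]
    split_ifs <;> omega
  · simp [hi]

/-- Insertion into the rearranged permutation, indexed by the increase of `denr`. -/
noncomputable def gainInsert (r : ℕ) (p : Equiv.Perm (Fin N) × Fin (N + 1)) :
    Equiv.Perm (Fin (N + 1)) :=
  let q := reflectRank r (p.1, (gainPerm r p.1).symm p.2)
  insertPlace r q.1 q.2

theorem gainInsert_bijective (hr : r ≤ N + 1) : Function.Bijective (gainInsert (N := N) r) := by
  rw [Fintype.bijective_iff_injective_and_card]
  constructor
  · rintro ⟨π, c⟩ ⟨π', c'⟩ h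
    obtain ⟨h1, h2⟩ := insertPlace_injective hr h
    have h3 := (reflectRank_involutive hr).injective (Prod.ext h1 h2)
    simp only [Prod.mk.injEq] at h3
    obtain ⟨rfl, h4⟩ := h3
    rw [(gainPerm r π).symm.injective h4]
  · simp [Fintype.card_perm, Nat.factorial_succ, mul_comm]

theorem gainInsert_spec (hr : r ≤ N + 1) (hr' : 1 ≤ r) (π : Equiv.Perm (Fin N))
    (c : Fin (N + 1)) :
    ((c : ℕ) ≤ excr r π + r - 1 → excr r (gainInsert r (π, c)) = excr r π) ∧
    (excr r π + r - 1 < (c : ℕ) → excr r (gainInsert r (π, c)) = excr r π + 1) ∧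
    denr r (gainInsert r (π, c)) = denr r π + c := by
  obtain ⟨v, rfl⟩ := (gainPerm r π).surjective c
  have h1 := excr_le_numExc (r := r) π
  have h2 := numExc_le_excr_add (r := r) π
  simp only [gainInsert, Equiv.symm_apply_apply, gainPerm_apply]
  rcases le_or_gt r ((v : ℕ) + 1) with hv | hv
  · rw [reflectRank_of_le (p := (π, v)) hv]
    simp only [denr_insertPlace hr, excr_insertPlace_of_le hr π hv, and_true]
    rcases newLetter_eq_or_lt r π v with h | h
    · have := insertGain_le_of_eq h
      rw [if_neg (by rw [h]; exact lt_irrefl v)]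
      omega
    · have := numExc_add_le_insertGain h hv
      rw [if_pos h]
      omega
  · obtain ⟨l, g, hl, hg⟩ := exists_level hr hv
    have hgl : g ≤ l := by rw [Fin.le_def]; omega
    have hτ : levelRank r π l ≤ l := (levelRank_le_iff hl).2 le_rfl
    rw [Fin.le_def] at hτ
    obtain ⟨h3, h4⟩ := reflectRank_of_lt (p := (π, v)) hl hg
    have hv' : ((reflectRank r (π, v)).2 : ℕ) + 1 < r := by omega
    have hd := denr_setRank (π := π) hl hgl
    have he := levelExc_iff_levelRank_lt (π := setRank r π l g) hl
    rw [levelRank_setRank_self hl hgl, excr_setRank hl hgl, numExc_setRank hl hgl] at he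
    rw [denr_insertPlace hr, excr_insertPlace_of_lt hr _ hv' hl, insertGain_of_val_lt hr _ hv',
      insertGain_of_val_lt hr _ hv, h3, h4, excr_setRank hl hgl, numExc_setRank hl hgl]
    simp only at hg ⊢
    refine ⟨fun h => ?_, fun h => ?_, by omega⟩
    · rw [if_neg (by rw [he]; omega), add_zero]
    · rw [if_pos (by rw [he]; omega)]

end Bijection

/-- For 1 ≤ r < n there is a bijection Φ from S_{n-1} × {0,…,n-1}
onto S_n such that exc_r(Φ(π,c)) = exc_r(π) if c ≤ exc_r(π) + r - 1 and
exc_r(Φ(π,c)) = exc_r(π) + 1 otherwise, and den_r(Φ(π,c)) = den_r(π) + c. -/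
theorem exists_bijection_excr_denr (n r : ℕ) (hr : 1 ≤ r) (hrn : r < n) :
    ∃ Φ : Equiv.Perm (Fin (n - 1)) × Fin n → Equiv.Perm (Fin n),
      Function.Bijective Φ ∧
      ∀ (π : Equiv.Perm (Fin (n - 1))) (c : Fin n),
        ((c : ℕ) ≤ excr r π + r - 1 → excr r (Φ (π, c)) = excr r π) ∧
        (excr r π + r - 1 < (c : ℕ) → excr r (Φ (π, c)) = excr r π + 1) ∧
        denr r (Φ (π, c)) = denr r π + (c : ℕ) := by
  obtain ⟨N, rfl⟩ : ∃ N, n = N + 1 := ⟨n - 1, by omega⟩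
  exact ⟨gainInsert r, gainInsert_bijective hrn.le, gainInsert_spec hrn.le hr⟩
end

section
/- Let n ≥ 1 and r ≥ 1 be integers. Then there exists a bijection φ from S_{n-1} × {0, 1, ..., n-1} onto S_n such that for every π ∈ S_{n-1} and every c with 0 ≤ c ≤ n-1: rdes(φ(π,c)) = rdes(π) if 0 ≤ c ≤ rdes(π) + r - 1, and rdes(φ(π,c)) = rdes(π) + 1 otherwise; and rmaj(φ(π,c)) = rmaj(π) + c. -/
open Finset

/-- The permutation of `Fin (N + 1)` obtained from the one-line notation of `π` by inserting the
largest letter at the (0-based) position `k`. -/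
def insertMax {N : ℕ} (π : Equiv.Perm (Fin N)) (k : Fin (N + 1)) : Equiv.Perm (Fin (N + 1)) :=
  ((finSuccEquiv' k).trans (Equiv.optionCongr π)).trans (finSuccEquiv' (Fin.last N)).symm

lemma insertMax_self {N : ℕ} (π : Equiv.Perm (Fin N)) (k : Fin (N + 1)) :
    insertMax π k k = Fin.last N := by
  simp [insertMax]

lemma insertMax_succAbove {N : ℕ} (π : Equiv.Perm (Fin N)) (k : Fin (N + 1)) (i : Fin N) :
    insertMax π k (k.succAbove i) = (π i).castSucc := by
  simp [insertMax]

lemma insertMax_injective {N : ℕ} {π π' : Equiv.Perm (Fin N)} {k k' : Fin (N + 1)}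
    (h : insertMax π k = insertMax π' k') : π = π' ∧ k = k' := by
  have hk : k = k' := by
    apply (insertMax π' k').injective
    rw [insertMax_self, ← h, insertMax_self]
  subst hk
  refine ⟨Equiv.ext fun i => ?_, rfl⟩
  have := insertMax_succAbove π k i
  rw [h, insertMax_succAbove] at this
  exact (Fin.castSucc_injective _ this).symm

lemma pval_insertMax {N : ℕ} (π : Equiv.Perm (Fin N)) (k : Fin (N + 1)) (i : ℕ) :
    pval (insertMax π k) i =
      if i ≤ k then pval π i else if i = k + 1 then N + 1 else pval π (i - 1) := by
  have hk := k.isLt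
  unfold pval
  split_ifs with h1 h2 h3 h4 h5 h6 <;> try omega
  · have := insertMax_succAbove π k ⟨i - 1, by omega⟩
    rw [Fin.succAbove_of_castSucc_lt _ _ (by simp [Fin.lt_def]; omega)] at this
    simp only [Fin.castSucc_mk] at this
    simp [this]
  · have h : (⟨i - 1, by omega⟩ : Fin (N + 1)) = k := Fin.ext (by simp; omega)
    rw [h, insertMax_self]; simp
  · have := insertMax_succAbove π k ⟨i - 1 - 1, by omega⟩
    rw [Fin.succAbove_of_le_castSucc _ _ (by simp [Fin.le_def]; omega)] at this
    have e : (Fin.succ ⟨i - 1 - 1, by omega⟩ : Fin (N + 1)) = ⟨i - 1, by omega⟩ :=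
      Fin.ext (by simp; omega)
    rw [e] at this
    simp [this]

lemma pval_pos {N : ℕ} (π : Equiv.Perm (Fin N)) {i : ℕ} (h : 1 ≤ i) (h' : i ≤ N) :
    1 ≤ pval π i := by
  simp [pval, h, h']

lemma pval_le {N : ℕ} (π : Equiv.Perm (Fin N)) (i : ℕ) : pval π i ≤ N := by
  unfold pval
  split_ifs
  · exact Fin.isLt _
  · omega

/-- The positions of the letters of `π ∈ S_N` that exceed `N + 1 - r`. -/
def largeSet {N : ℕ} (r : ℕ) (π : Equiv.Perm (Fin N)) : Finset ℕ :=
  (Finset.Icc 1 N).filter (fun j => N + 1 < pval π j + r)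

lemma card_largeSet {N : ℕ} (r : ℕ) (hr : 1 ≤ r) (π : Equiv.Perm (Fin N)) :
    (largeSet r π).card = min (r - 1) N := by
  have hinj : Set.InjOn (pval π) (largeSet r π) := by
    intro i hi j hj hij
    simp only [largeSet, coe_filter, mem_Icc, Set.mem_ofPred_eq] at hi hj
    simp only [pval, hi.1.1, hi.1.2, hj.1.1, hj.1.2, and_self, dite_true, add_left_inj] at hij
    have := congrArg Fin.val (π.injective (Fin.ext hij))
    simp only at this
    omega
  have himg : (largeSet r π).image (pval π) = Finset.Icc (max 1 (N + 2 - r)) N := by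
    ext x
    simp only [largeSet, mem_image, mem_filter, mem_Icc]
    constructor
    · rintro ⟨j, ⟨⟨h1, h2⟩, h3⟩, rfl⟩
      have := pval_pos π h1 h2
      have := pval_le π j
      omega
    · rintro ⟨h1, h2⟩
      have hx : pval π ((π.symm ⟨x - 1, by omega⟩ : Fin N) + 1) = x := by
        simp [pval]; omega
      exact ⟨_, ⟨⟨by omega, by omega⟩, by rw [hx]; omega⟩, hx⟩
  rw [← card_image_of_injOn hinj, himg, Nat.card_Icc]
  omega

lemma mem_rDesSet {N : ℕ} {r : ℕ} {π : Equiv.Perm (Fin N)} {i : ℕ} :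
    i ∈ rDesSet r π ↔ (1 ≤ i ∧ i + 1 ≤ N) ∧ pval π (i + 1) + r ≤ pval π i := by
  simp only [rDesSet, mem_filter, mem_Icc]
  constructor <;> rintro ⟨⟨h1, h2⟩, h3⟩ <;> exact ⟨by omega, h3⟩

/-- The places `k < N` where inserting the largest letter creates no new `r`-descent. -/
def neutralSet {N : ℕ} (r : ℕ) (π : Equiv.Perm (Fin N)) : Finset ℕ :=
  rDesSet r π ∪ (largeSet r π).image (· - 1)

lemma mem_neutralSet {N : ℕ} {r : ℕ} {π : Equiv.Perm (Fin N)} {k : ℕ} :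
    k ∈ neutralSet r π ↔ k ∈ rDesSet r π ∨ k + 1 ∈ largeSet r π := by
  simp only [neutralSet, mem_union, mem_image]
  refine or_congr_right ⟨?_, fun h => ⟨_, h, rfl⟩⟩
  rintro ⟨j, hj, rfl⟩
  have : 1 ≤ j := by simp only [largeSet, mem_filter, mem_Icc] at hj; omega
  rwa [Nat.sub_add_cancel this]

lemma succ_notMem_largeSet {N : ℕ} {r : ℕ} {π : Equiv.Perm (Fin N)} {k : ℕ}
    (h : k ∈ rDesSet r π) : k + 1 ∉ largeSet r π := by
  have := pval_le π k
  rw [mem_rDesSet] at h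
  simp only [largeSet, mem_filter]
  omega

lemma neutralSet_subset {N : ℕ} (r : ℕ) (π : Equiv.Perm (Fin N)) :
    neutralSet r π ⊆ Finset.range N := by
  intro k hk
  rw [mem_neutralSet, mem_rDesSet, largeSet, mem_filter, mem_Icc] at hk
  rw [mem_range]
  omega

lemma card_filter_neutralSet {N : ℕ} (r : ℕ) (π : Equiv.Perm (Fin N)) (k : ℕ) :
    ((neutralSet r π).filter (k ≤ ·)).card =
      ((rDesSet r π).filter (k ≤ ·)).card + ((largeSet r π).filter (k < ·)).card := by
  have h : (neutralSet r π).filter (k ≤ ·) =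
      (rDesSet r π).filter (k ≤ ·) ∪ ((largeSet r π).filter (k < ·)).image (· - 1) := by
    ext i
    simp only [mem_filter, mem_neutralSet, mem_union, mem_image]
    constructor
    · rintro ⟨h | h, hk⟩
      · exact Or.inl ⟨h, hk⟩
      · exact Or.inr ⟨i + 1, ⟨h, by omega⟩, rfl⟩
    · rintro (⟨h, hk⟩ | ⟨j, ⟨h, hk⟩, rfl⟩)
      · exact ⟨Or.inl h, hk⟩
      · exact ⟨Or.inr (by rwa [Nat.sub_add_cancel (by omega)]), by omega⟩
  rw [h, card_union_of_disjoint, card_image_of_injOn]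
  · intro i hi j hj hij
    simp only [coe_filter, Set.mem_ofPred_eq] at hi hj hij
    omega
  · rw [disjoint_left]
    intro i hi hj
    simp only [mem_filter, mem_image] at hi hj
    obtain ⟨j, ⟨hj, hkj⟩, rfl⟩ := hj
    exact succ_notMem_largeSet hi.1 (by rwa [Nat.sub_add_cancel (by omega)])

lemma card_neutralSet {N : ℕ} (r : ℕ) (hr : 1 ≤ r) (π : Equiv.Perm (Fin N)) :
    (neutralSet r π).card = rdes r π + min (r - 1) N := by
  have h := card_filter_neutralSet r π 0
  rw [filter_true_of_mem (by simp), filter_true_of_mem (by simp), filter_true_of_mem] at h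
  · rw [h, card_largeSet r hr, rdes]
  · intro j hj
    simp only [largeSet, mem_filter, mem_Icc] at hj
    omega

/-- The labelling of the places `0, …, N`: places of `C ∪ {N}` are numbered from right to left
starting from `0`, then the remaining places from left to right. -/
def placeLabel (N : ℕ) (C : Finset ℕ) (k : ℕ) : ℕ :=
  (C.filter (k ≤ ·)).card + if k ∈ C ∨ k = N then 0 else k + 1

lemma card_filter_le_step (C : Finset ℕ) (k : ℕ) :
    (C.filter (k ≤ ·)).card = (C.filter (k + 1 ≤ ·)).card + if k ∈ C then 1 else 0 := by
  split_ifs with h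
  · have : C.filter (k ≤ ·) = insert k (C.filter (k + 1 ≤ ·)) := by
      ext i
      simp only [mem_filter, mem_insert]
      constructor
      · rintro ⟨h1, h2⟩
        rcases h2.eq_or_lt with h3 | h3
        · exact Or.inl h3.symm
        · exact Or.inr ⟨h1, h3⟩
      · rintro (rfl | ⟨h1, h2⟩)
        · exact ⟨h, le_rfl⟩
        · exact ⟨h1, by omega⟩
    rw [this, card_insert_of_notMem (by simp)]
  · rw [add_zero]
    congr 1
    ext i
    simp only [mem_filter]
    refine and_congr_right fun hi => ?_
    have : i ≠ k := by rintro rfl; exact h hi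
    omega

lemma card_filter_le_antitone (C : Finset ℕ) :
    Antitone fun k => (C.filter (k ≤ ·)).card :=
  antitone_nat_of_succ_le fun k => by
    have := card_filter_le_step C k
    omega

lemma card_filter_le_add_monotone (C : Finset ℕ) :
    Monotone fun k => (C.filter (k ≤ ·)).card + k :=
  monotone_nat_of_le_succ fun k => by
    have := card_filter_le_step C k
    split_ifs at this <;> omega

lemma card_filter_le_eq_zero {N : ℕ} {C : Finset ℕ} (hC : C ⊆ Finset.range N) :
    (C.filter (N ≤ ·)).card = 0 := by
  rw [card_eq_zero, filter_eq_empty_iff]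
  intro i hi
  have := mem_range.1 (hC hi)
  omega

lemma placeLabel_le_card_iff {N : ℕ} (C : Finset ℕ) (k : ℕ) :
    placeLabel N C k ≤ C.card ↔ k ∈ C ∨ k = N := by
  have h0 := card_filter_le_add_monotone C (Nat.zero_le k)
  simp only [filter_true_of_mem (fun i _ => Nat.zero_le i : ∀ i ∈ C, 0 ≤ i)] at h0
  have h1 := card_filter_le C (k ≤ ·)
  unfold placeLabel
  split_ifs with h
  · simpa [h] using h1
  · simp only [h, iff_false]
    omega

lemma placeLabel_le {N : ℕ} {C : Finset ℕ} (hC : C ⊆ Finset.range N) {k : ℕ} (hk : k ≤ N) :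
    placeLabel N C k ≤ N := by
  by_cases h : k ∈ C ∨ k = N
  · exact ((placeLabel_le_card_iff C k).2 h).trans (by simpa using card_le_card hC)
  · have h1 := card_filter_le_step C k
    have h2 := card_filter_le_add_monotone C (show k + 1 ≤ N by omega)
    simp only [card_filter_le_eq_zero hC] at h2
    rw [if_neg (by tauto)] at h1
    unfold placeLabel
    rw [if_neg h]
    omega

lemma placeLabel_ne_of_lt {N : ℕ} {C : Finset ℕ} {k l : ℕ} (hkl : k < l) (hl : l ≤ N) :
    placeLabel N C k ≠ placeLabel N C l := by
  intro heq
  have hiff := placeLabel_le_card_iff (N := N) C k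
  rw [heq, placeLabel_le_card_iff] at hiff
  have h1 := card_filter_le_step C k
  have h2 := card_filter_le_add_monotone C (Nat.succ_le_of_lt hkl)
  have h3 := card_filter_le_antitone C (Nat.succ_le_of_lt hkl)
  simp only [Nat.succ_eq_add_one] at h2 h3
  unfold placeLabel at heq
  by_cases h : k ∈ C ∨ k = N
  · have hk : k ∈ C := h.resolve_right (by omega)
    rw [if_pos h, if_pos (hiff.2 h)] at heq
    rw [if_pos hk] at h1
    omega
  · rw [if_neg h, if_neg (fun h' => h (hiff.1 h'))] at heq
    rw [if_neg (by tauto)] at h1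
    omega

lemma rDesSet_insertMax {N : ℕ} (r : ℕ) (hr : 1 ≤ r) (π : Equiv.Perm (Fin N)) (k : Fin (N + 1)) :
    rDesSet r (insertMax π k) =
      ((rDesSet r π).filter (· < (k : ℕ)) ∪ ((rDesSet r π).filter ((k : ℕ) < ·)).image (· + 1)) ∪
        if (k : ℕ) + 1 ∈ largeSet r π ∨ (k : ℕ) = N then ∅ else {(k : ℕ) + 1} := by
  have hk := k.isLt
  ext i
  have hle := pval_le π i
  have hlarge : (k : ℕ) + 1 ∈ largeSet r π ↔ (k : ℕ) + 1 ≤ N ∧ N + 1 < pval π (k + 1) + r := by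
    simp [largeSet]
  have himg : i ∈ ((rDesSet r π).filter ((k : ℕ) < ·)).image (· + 1) ↔
      (k : ℕ) + 1 < i ∧ i - 1 ∈ rDesSet r π := by
    simp only [mem_image, mem_filter]
    constructor
    · rintro ⟨j, ⟨hj, hkj⟩, rfl⟩
      exact ⟨by omega, by simpa using hj⟩
    · rintro ⟨h1, h2⟩
      exact ⟨i - 1, ⟨h2, by omega⟩, by omega⟩
  have hlast : (i ∈ if (k : ℕ) + 1 ∈ largeSet r π ∨ (k : ℕ) = N then (∅ : Finset ℕ)
      else {(k : ℕ) + 1}) ↔ i = k + 1 ∧ ¬ ((k : ℕ) + 1 ∈ largeSet r π ∨ (k : ℕ) = N) := by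
    split_ifs with h <;> simp [h]
  rw [mem_union, mem_union, himg, hlast, hlarge, mem_filter, mem_rDesSet, mem_rDesSet,
    mem_rDesSet, pval_insertMax, pval_insertMax]
  rcases lt_trichotomy i (k + 1) with h | h | h
  · rcases (Nat.lt_succ_iff.1 h).eq_or_lt with h' | h'
    · simp only [h', le_refl, if_true, Nat.not_succ_le_self, if_false]
      have := pval_le π k
      omega
    · rw [if_pos (by omega), if_pos (by omega)]
      omega
  · subst h
    rw [if_neg (by omega), if_neg (by omega), if_neg (by omega), if_pos rfl, Nat.add_sub_cancel]
    omega
  · rw [if_neg (by omega), if_neg (by omega), if_neg (by omega), if_neg (by omega),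
      Nat.add_sub_cancel, Nat.sub_add_cancel (by omega)]
    omega

lemma sum_rDesSet_insertMax {N : ℕ} (r : ℕ) (hr : 1 ≤ r) (π : Equiv.Perm (Fin N))
    (k : Fin (N + 1)) (f : ℕ → ℕ) :
    ∑ i ∈ rDesSet r (insertMax π k), f i =
      ∑ i ∈ (rDesSet r π).filter (· < (k : ℕ)), f i +
        ∑ i ∈ (rDesSet r π).filter ((k : ℕ) < ·), f (i + 1) +
        if (k : ℕ) + 1 ∈ largeSet r π ∨ (k : ℕ) = N then 0 else f (k + 1) := by
  rw [rDesSet_insertMax r hr, sum_union, sum_union, sum_image (by simp)]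
  · split_ifs <;> simp
  · rw [disjoint_left]
    intro i hi hj
    simp only [mem_filter, mem_image] at hi hj
    obtain ⟨j, hj, rfl⟩ := hj
    omega
  · split_ifs
    · simp
    · simp only [disjoint_singleton_right, mem_union, mem_filter, mem_image]
      rintro (h | ⟨j, hj, hj'⟩) <;> omega

lemma sum_rDesSet_split {N : ℕ} (r : ℕ) (π : Equiv.Perm (Fin N)) (k : ℕ) (f : ℕ → ℕ) :
    ∑ i ∈ rDesSet r π, f i =
      ∑ i ∈ (rDesSet r π).filter (· < k), f i + ∑ i ∈ (rDesSet r π).filter (k < ·), f i +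
        if k ∈ rDesSet r π then f k else 0 := by
  simp only [sum_filter]
  rw [← sum_add_distrib, ← sum_ite_eq' (rDesSet r π) k f, ← sum_add_distrib]
  refine sum_congr rfl fun i _ => ?_
  split_ifs <;> omega

lemma card_rInvSet_insertMax {N : ℕ} (r : ℕ) (π : Equiv.Perm (Fin N))
    (k : Fin (N + 1)) :
    (rInvSet r (insertMax π k)).card =
      (rInvSet r π).card + ((largeSet r π).filter ((k : ℕ) < ·)).card := by
  have hk := k.isLt
  set s : ℕ → ℕ := fun i => if i ≤ k then i else i + 1 with hs
  have hsinj : Function.Injective s := by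
    intro i j h
    simp only [hs] at h
    split_ifs at h <;> omega
  have hsv : ∀ i, pval (insertMax π k) (s i) = pval π i := by
    intro i
    rw [pval_insertMax]
    by_cases h : i ≤ k
    · simp [hs, h]
    · simp only [hs, h, if_false]
      rw [if_neg (by omega), if_neg (by omega), Nat.add_sub_cancel]
  have hkv : pval (insertMax π k) (k + 1) = N + 1 := by
    rw [pval_insertMax]; simp
  have hcov : ∀ i, 1 ≤ i → i ≤ N + 1 → i = k + 1 ∨ ∃ j, 1 ≤ j ∧ j ≤ N ∧ s j = i := by
    intro i h1 h2
    rcases lt_trichotomy i (k + 1) with h | h | h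
    · exact Or.inr ⟨i, by omega, by omega, if_pos (by omega)⟩
    · exact Or.inl h
    · exact Or.inr ⟨i - 1, by omega, by omega, by simp only [hs]; rw [if_neg (by omega)]; omega⟩
  have hsb : ∀ i, 1 ≤ i → i ≤ N → 1 ≤ s i ∧ s i ≤ N + 1 := by
    intro i h1 h2
    simp only [hs]; split_ifs <;> omega
  have hslt : ∀ i j, s i < s j ↔ i < j := by
    intro i j
    simp only [hs]; split_ifs <;> omega
  have hskl : ∀ j, (k : ℕ) + 1 < s j ↔ k < j := by
    intro j
    simp only [hs]; split_ifs <;> omega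
  have h : rInvSet r (insertMax π k) = (rInvSet r π).image (Prod.map s s) ∪
      ((largeSet r π).filter ((k : ℕ) < ·)).image (fun j => ((k : ℕ) + 1, s j)) := by
    ext ⟨a, b⟩
    simp only [mem_union, mem_image, Prod.exists, Prod.map_apply, Prod.mk.injEq]
    simp only [rInvSet, largeSet, mem_filter, mem_product, mem_Icc]
    constructor
    · rintro ⟨⟨⟨ha1, ha2⟩, hb1, hb2⟩, hab, hv1, hv2⟩
      rcases hcov b hb1 hb2 with rfl | ⟨j, hj1, hj2, rfl⟩
      · rw [hkv] at hv1
        have := pval_le (insertMax π k) a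
        omega
      rcases hcov a ha1 ha2 with rfl | ⟨i, hi1, hi2, rfl⟩
      · rw [hkv, hsv] at hv2
        exact Or.inr ⟨j, ⟨⟨⟨hj1, hj2⟩, hv2⟩, (hskl j).1 hab⟩, rfl, rfl⟩
      · rw [hsv, hsv] at hv1 hv2
        exact Or.inl ⟨i, j, ⟨⟨⟨hi1, hi2⟩, hj1, hj2⟩, (hslt i j).1 hab, hv1, hv2⟩, rfl, rfl⟩
    · rintro (⟨i, j, ⟨⟨⟨hi1, hi2⟩, hj1, hj2⟩, hab, hv⟩, rfl, rfl⟩ |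
        ⟨j, ⟨⟨⟨hj1, hj2⟩, hv⟩, hkj⟩, rfl, rfl⟩)
      · rw [hsv, hsv, hslt]
        exact ⟨⟨hsb i hi1 hi2, hsb j hj1 hj2⟩, hab, hv⟩
      · rw [hsv, hkv, hskl]
        have := pval_le π j
        exact ⟨⟨by omega, hsb j hj1 hj2⟩, hkj, by omega, hv⟩
  rw [h, card_union_of_disjoint, card_image_of_injective _ (hsinj.prodMap hsinj),
    card_image_of_injective]
  · intro i j hij
    exact hsinj (Prod.mk.inj hij).2
  · rw [disjoint_left]
    rintro ⟨a, b⟩ h1 h2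
    simp only [mem_image, Prod.exists, Prod.map_apply, Prod.mk.injEq] at h1 h2
    obtain ⟨i, j, -, rfl, -⟩ := h1
    obtain ⟨l, -, h3, -⟩ := h2
    simp only [hs] at h3
    split_ifs at h3 <;> omega

lemma rdes_insertMax {N : ℕ} (r : ℕ) (hr : 1 ≤ r) (π : Equiv.Perm (Fin N)) (k : Fin (N + 1)) :
    rdes r (insertMax π k) =
      rdes r π + if (k : ℕ) ∈ neutralSet r π ∨ (k : ℕ) = N then 0 else 1 := by
  have h1 := sum_rDesSet_insertMax r hr π k (fun _ => 1)
  have h2 := sum_rDesSet_split r π k (fun _ => 1)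
  have h3 := succ_notMem_largeSet (r := r) (π := π) (k := k)
  have h4 : (k : ℕ) ∈ rDesSet r π → (k : ℕ) ≠ N := fun h => by rw [mem_rDesSet] at h; omega
  simp only [← card_eq_sum_ones] at h1 h2
  rw [rdes, rdes, h1, h2]
  simp only [mem_neutralSet]
  by_cases hD : (k : ℕ) ∈ rDesSet r π
  · simp [hD, h3 hD, h4 hD]
  · simp [hD]

lemma rmaj_insertMax {N : ℕ} (r : ℕ) (hr : 1 ≤ r) (π : Equiv.Perm (Fin N)) (k : Fin (N + 1)) :
    rmaj r (insertMax π k) = rmaj r π + placeLabel N (neutralSet r π) k := by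
  have h1 := sum_rDesSet_insertMax r hr π k (fun i => i)
  have h2 := sum_rDesSet_split r π k (fun i => i)
  have h3 := succ_notMem_largeSet (r := r) (π := π) (k := k)
  have h4 : (k : ℕ) ∈ rDesSet r π → (k : ℕ) ≠ N := fun h => by rw [mem_rDesSet] at h; omega
  have h5 := card_filter_le_step (rDesSet r π) k
  have h6 := card_filter_neutralSet r π k
  have h7 := card_rInvSet_insertMax r π k
  simp only [sum_add_distrib, ← card_eq_sum_ones, Nat.succ_le_iff] at h1 h2 h5
  rw [rmaj, rmaj, placeLabel, h1, h2, h6, h5, h7]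
  simp only [mem_neutralSet]
  by_cases hD : (k : ℕ) ∈ rDesSet r π
  · simp only [hD, h3 hD, h4 hD, or_self, true_or, if_true, if_false]
    omega
  · simp only [hD, false_or, if_false]
    omega

/-- The place labelling of `π` as a permutation of `{0, …, N}`. -/
noncomputable def labelEquiv {N : ℕ} (r : ℕ) (π : Equiv.Perm (Fin N)) :
    Equiv.Perm (Fin (N + 1)) :=
  Equiv.ofBijective
    (fun k => ⟨placeLabel N (neutralSet r π) k,
      Nat.lt_succ_of_le (placeLabel_le (neutralSet_subset r π) (Nat.le_of_lt_succ k.isLt))⟩)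
    (Finite.injective_iff_bijective.1 fun k l h => by
      have h' := congrArg Fin.val h
      simp only at h'
      rcases lt_trichotomy (k : ℕ) l with hkl | hkl | hkl
      · exact absurd h' (placeLabel_ne_of_lt hkl (Nat.le_of_lt_succ l.isLt))
      · exact Fin.ext hkl
      · exact absurd h'.symm (placeLabel_ne_of_lt hkl (Nat.le_of_lt_succ k.isLt)))

lemma placeLabel_labelEquiv_symm {N : ℕ} (r : ℕ) (π : Equiv.Perm (Fin N)) (c : Fin (N + 1)) :
    placeLabel N (neutralSet r π) ((labelEquiv r π).symm c) = c :=
  congrArg Fin.val ((labelEquiv r π).apply_symm_apply c)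

/-- For n ≥ 1 and r ≥ 1 there is a bijection φ from
S_{n-1} × {0,…,n-1} onto S_n such that rdes(φ(π,c)) = rdes(π) if
c ≤ rdes(π) + r - 1 and rdes(φ(π,c)) = rdes(π) + 1 otherwise, and
rmaj(φ(π,c)) = rmaj(π) + c. -/
theorem exists_bijection_rdes_rmaj (n r : ℕ) (hn : 1 ≤ n) (hr : 1 ≤ r) :
    ∃ φ : Equiv.Perm (Fin (n - 1)) × Fin n → Equiv.Perm (Fin n),
      Function.Bijective φ ∧
      ∀ (π : Equiv.Perm (Fin (n - 1))) (c : Fin n),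
        ((c : ℕ) ≤ rdes r π + r - 1 → rdes r (φ (π, c)) = rdes r π) ∧
        (rdes r π + r - 1 < (c : ℕ) → rdes r (φ (π, c)) = rdes r π + 1) ∧
        rmaj r (φ (π, c)) = rmaj r π + (c : ℕ) := by
  obtain ⟨N, rfl⟩ : ∃ N, n = N + 1 := ⟨n - 1, by omega⟩
  change ∃ φ : Equiv.Perm (Fin N) × Fin (N + 1) → Equiv.Perm (Fin (N + 1)), _ ∧
    ∀ (π : Equiv.Perm (Fin N)) (c : Fin (N + 1)), _
  refine ⟨fun x => insertMax x.1 ((labelEquiv r x.1).symm x.2), ?_, fun π c => ?_⟩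
  · rw [Fintype.bijective_iff_injective_and_card]
    refine ⟨?_, ?_⟩
    · rintro ⟨π, c⟩ ⟨π', c'⟩ h
      obtain ⟨h1, h2⟩ := insertMax_injective h
      simp only at h1 h2
      subst h1
      rw [(labelEquiv r π).symm.injective h2]
    · simp [Fintype.card_perm, Nat.factorial_succ, mul_comm]
  · have hc := placeLabel_labelEquiv_symm r π c
    have hiff := placeLabel_le_card_iff (N := N) (neutralSet r π) ((labelEquiv r π).symm c)
    have hlt := c.isLt
    rw [hc, card_neutralSet r hr] at hiff
    refine ⟨fun h => ?_, fun h => ?_, ?_⟩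
    · rw [rdes_insertMax r hr, if_pos (hiff.1 (by omega)), add_zero]
    · rw [rdes_insertMax r hr, if_neg (fun h' => by have := hiff.2 h'; omega)]
    · rw [rmaj_insertMax r hr, hc]
end
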